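/- arXiv:1807.02742 — 8 statements merged into one kernel-verified Lean document; each statement's English description precedes it below -/
import Mathlib

section
/- Let g ≥ 1 and let S ⊆ ℕ be a set containing 0 and closed under addition whose set of gaps H = {n ≥ 1 : n ∉ S} has exactly g elements, all contained in {1, ..., 2g−1}. Write the gaps in increasing order as n_1 < n_2 < ... < n_g and define the weight w = Σ_{i=1}^{g} (n_i − i). Then w ≤ g(g−1)/2, with equality if and only if the gap set is {1, 3, 5, ..., 2g−1}. -/
theorem sum_Icc_one_sub_one (g : ℕ) : ∑ i ∈ Finset.Icc 1 g, (i - 1) = g * (g - 1) / 2 := by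
  rw [← Finset.sum_range_id, Finset.range_eq_Ico, ← Finset.Ico_add_one_right_eq_Icc,
    Finset.sum_Ico_eq_sum_range]
  simp

/-- The `i`-th gap of a set closed under addition is at most `2 * i - 1`. -/
theorem gap_le_two_mul_sub_one {g : ℕ} {S : Set ℕ} (hadd : ∀ a ∈ S, ∀ b ∈ S, a + b ∈ S)
    {n : ℕ → ℕ} (hmono : StrictMonoOn n (Set.Icc 1 g))
    (hmem : ∀ i ∈ Set.Icc 1 g, n i ∈ {m : ℕ | 1 ≤ m ∧ m ∉ S})
    (hsurj : ∀ x ∈ {m : ℕ | 1 ≤ m ∧ m ∉ S}, ∃ i ∈ Set.Icc 1 g, n i = x)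
    {i : ℕ} (hi : i ∈ Set.Icc 1 g) : n i ≤ 2 * i - 1 := by
  have key : ∀ a, 1 ≤ a → a < n i → a ∉ S → ∃ j ∈ Finset.Ico 1 i, n j = a := by
    intro a ha hai haS
    obtain ⟨j, hj, rfl⟩ := hsurj a ⟨ha, haS⟩
    exact ⟨j, Finset.mem_Ico.2 ⟨hj.1, (hmono.lt_iff_lt hj hi).1 hai⟩, rfl⟩
  have hcover : Finset.Ico 1 (n i) ⊆
      (Finset.Ico 1 i).image n ∪ (Finset.Ico 1 i).image (fun j => n i - n j) := by
    intro a ha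
    rw [Finset.mem_Ico] at ha
    rw [Finset.mem_union, Finset.mem_image, Finset.mem_image]
    by_cases haS : a ∈ S
    · right
      have hb : n i - a ∉ S := fun hb => (hmem i hi).2 <| by
        simpa [Nat.add_sub_cancel' ha.2.le] using hadd a haS _ hb
      obtain ⟨j, hj, hja⟩ := key (n i - a) (by omega) (by omega) hb
      exact ⟨j, hj, by omega⟩
    · exact Or.inl (key a ha.1 ha.2 haS)
  have hle := (Finset.card_le_card hcover).trans (Finset.card_union_le _ _)
  have h₁ := Finset.card_image_le (s := Finset.Ico 1 i) (f := n)
  have h₂ := Finset.card_image_le (s := Finset.Ico 1 i) (f := fun j => n i - n j)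
  rw [Nat.card_Ico] at hle h₁ h₂
  have := hi.1
  omega

/-- A strictly increasing sequence of odd numbers satisfies `2 * i - 1 ≤ n i`. -/
theorem two_mul_sub_one_le_of_odd {g : ℕ} {n : ℕ → ℕ} (hmono : StrictMonoOn n (Set.Icc 1 g))
    (hodd : ∀ i ∈ Set.Icc 1 g, Odd (n i)) {i : ℕ} (hi : i ∈ Set.Icc 1 g) :
    2 * i - 1 ≤ n i := by
  obtain ⟨h1, hig⟩ := hi
  induction i, h1 using Nat.le_induction with
  | base => exact (hodd 1 ⟨le_rfl, hig⟩).pos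
  | succ k hk ih =>
    have hk' : k ∈ Set.Icc 1 g := ⟨hk, by omega⟩
    have hlt := hmono hk' ⟨by omega, hig⟩ k.lt_succ_self
    obtain ⟨a, ha⟩ := hodd k hk'
    obtain ⟨b, hb⟩ := hodd (k + 1) ⟨by omega, hig⟩
    have := ih hk'.2
    omega

/-- **Maximal Weierstrass weight.** Let `S ⊆ ℕ` be a numerical semigroup (contains `0`, closed
under addition) whose gap set `H = {n ≥ 1 : n ∉ S}` has exactly `g ≥ 1` elements, all lying in
`{1, ..., 2g-1}`.  If `n 1 < n 2 < ... < n g` enumerates the gaps in increasing order and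
`w = Σ_{i=1}^{g} (n i - i)` is the weight, then `w ≤ g(g-1)/2`, with equality if and only if
the gap set is `{1, 3, 5, ..., 2g-1}` (the odd numbers at most `2g-1`). -/
theorem weierstrass_weight_le
    (g : ℕ) (hg : 1 ≤ g) (S : Set ℕ) (h0 : (0 : ℕ) ∈ S)
    (hadd : ∀ a ∈ S, ∀ b ∈ S, a + b ∈ S)
    (hfin : {m : ℕ | 1 ≤ m ∧ m ∉ S}.Finite)
    (hcard : hfin.toFinset.card = g)
    (hsub : {m : ℕ | 1 ≤ m ∧ m ∉ S} ⊆ Set.Icc 1 (2 * g - 1))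
    (n : ℕ → ℕ)
    (hmono : StrictMonoOn n (Set.Icc 1 g))
    (hmem : ∀ i ∈ Set.Icc 1 g, n i ∈ {m : ℕ | 1 ≤ m ∧ m ∉ S})
    (hsurj : ∀ x ∈ {m : ℕ | 1 ≤ m ∧ m ∉ S}, ∃ i ∈ Set.Icc 1 g, n i = x)
    (w : ℕ) (hw : w = ∑ i ∈ Finset.Icc 1 g, (n i - i)) :
    w ≤ g * (g - 1) / 2 ∧
      (w = g * (g - 1) / 2 ↔
        {m : ℕ | 1 ≤ m ∧ m ∉ S} = {m : ℕ | Odd m ∧ m ≤ 2 * g - 1}) := by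
  have hbound : ∀ i ∈ Set.Icc 1 g, n i ≤ 2 * i - 1 := fun i hi =>
    gap_le_two_mul_sub_one hadd hmono hmem hsurj hi
  have hterm : ∀ i ∈ Finset.Icc 1 g, n i - i ≤ i - 1 := fun i hi => by
    have := hbound i (Finset.mem_Icc.1 hi)
    omega
  rw [hw, ← sum_Icc_one_sub_one]
  refine ⟨Finset.sum_le_sum hterm, ?_⟩
  rw [Finset.sum_eq_sum_iff_of_le hterm]
  constructor
  · intro heq
    have hn : ∀ i ∈ Set.Icc 1 g, n i = 2 * i - 1 := fun i hi => by
      have h₁ := heq i (Finset.mem_Icc.2 hi)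
      have h₂ := hbound i hi
      have h₃ := (hmem i hi).1
      have h₄ := hi.1
      omega
    ext m
    constructor
    · intro hm
      obtain ⟨i, hi, rfl⟩ := hsurj m hm
      have h₁ := hn i hi
      obtain ⟨h₂, h₃⟩ := hi
      exact ⟨⟨i - 1, by omega⟩, by omega⟩
    · rintro ⟨⟨k, rfl⟩, hk⟩
      have hk' : k + 1 ∈ Set.Icc 1 g := ⟨by omega, by omega⟩
      have h₁ := hmem (k + 1) hk'
      rwa [hn (k + 1) hk', show 2 * (k + 1) - 1 = 2 * k + 1 by omega] at h₁
  · intro hH i hi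
    have hi' := Finset.mem_Icc.1 hi
    have hodd : ∀ i ∈ Set.Icc 1 g, Odd (n i) := fun i hi => (hH ▸ hmem i hi).1
    have h₁ := two_mul_sub_one_le_of_odd hmono hodd hi'
    have h₂ := hbound i hi'
    omega
end

section
/- Let g ≥ 2, n ≥ 1, g_0 ≥ 0 and r ≥ 0 be integers and let m_1, ..., m_r be integers with each m_i ≥ 2. If the Riemann–Hurwitz equation 2g − 2 = n(2g_0 − 2) + n·Σ_{i=1}^{r} (1 − 1/m_i) holds (as an equality of rational numbers), then n ≤ 84(g − 1). -/
theorem one_div_natCast_mem_or_le {m : ℕ} (hm : 2 ≤ m) :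
    (1 / (m : ℚ) = 1 / 2 ∨ 1 / (m : ℚ) = 1 / 3 ∨ 1 / (m : ℚ) = 1 / 4 ∨ 1 / (m : ℚ) = 1 / 5 ∨
      1 / (m : ℚ) = 1 / 6) ∨ (0 < 1 / (m : ℚ) ∧ 1 / (m : ℚ) ≤ 1 / 7) := by
  rcases le_or_gt 7 m with h | h
  · exact Or.inr ⟨by positivity, one_div_le_one_div_of_le (by norm_num) (by exact_mod_cast h)⟩
  · left
    interval_cases m <;> norm_num

theorem one_div_add_one_div_add_one_div_le {a b c : ℕ} (ha : 2 ≤ a) (hb : 2 ≤ b) (hc : 2 ≤ c)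
    (h : 1 / (a : ℚ) + 1 / (b : ℚ) + 1 / (c : ℚ) < 1) :
    1 / (a : ℚ) + 1 / (b : ℚ) + 1 / (c : ℚ) ≤ 41 / 42 := by
  wlog hab : 1 / (b : ℚ) ≤ 1 / (a : ℚ) generalizing a b c
  · linarith [this hb ha hc (by linarith) (by linarith)]
  wlog hbc : 1 / (c : ℚ) ≤ 1 / (b : ℚ) generalizing a b c
  · rcases le_total (1 / (c : ℚ)) (1 / (a : ℚ)) with hac | hac
    · linarith [this ha hc hb (by linarith) hac (by linarith)]
    · linarith [this hc ha hb (by linarith) hac hab]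
  rcases one_div_natCast_mem_or_le ha with (h₁ | h₁ | h₁ | h₁ | h₁) | ⟨h₁, h₁'⟩ <;>
  try linarith
  all_goals
    rcases one_div_natCast_mem_or_le hb with (h₂ | h₂ | h₂ | h₂ | h₂) | ⟨h₂, h₂'⟩ <;>
    try linarith
  all_goals
    rcases one_div_natCast_mem_or_le hc with (h₃ | h₃ | h₃ | h₃ | h₃) | ⟨h₃, h₃'⟩ <;>
    linarith

theorem one_div_natCast_eq_half_or_le_third {m : ℕ} (hm : 2 ≤ m) :
    1 / (m : ℚ) = 1 / 2 ∨ 1 / (m : ℚ) ≤ 1 / 3 := by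
  rcases one_div_natCast_mem_or_le hm with (h | h | h | h | h) | ⟨_, h⟩
  · exact Or.inl h
  all_goals exact Or.inr (by linarith)

theorem half_mul_le_sum_one_sub_one_div {r : ℕ} {m : ℕ → ℕ}
    (hm : ∀ i ∈ Finset.range r, 2 ≤ m i) :
    (r : ℚ) / 2 ≤ ∑ i ∈ Finset.range r, (1 - 1 / (m i : ℚ)) := by
  have h := Finset.card_nsmul_le_sum (Finset.range r) (fun i ↦ 1 - 1 / (m i : ℚ)) (1 / 2)
    fun i hi ↦ by
      rcases one_div_natCast_eq_half_or_le_third (hm i hi) with h | h <;> linarith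
  rw [Finset.card_range, nsmul_eq_mul] at h
  linarith

theorem sum_one_sub_one_div_le (r : ℕ) (m : ℕ → ℕ) :
    ∑ i ∈ Finset.range r, (1 - 1 / (m i : ℚ)) ≤ r := by
  have h := Finset.sum_le_card_nsmul (Finset.range r) (fun i ↦ 1 - 1 / (m i : ℚ)) 1
    fun i _ ↦ sub_le_self 1 (by positivity)
  simpa using h

/-- Two plus `1 / 42` is the least value above two of a sum of terms `1 - 1 / m` with `m ≥ 2`. -/
theorem le_sum_one_sub_one_div_of_two_lt {r : ℕ} {m : ℕ → ℕ}
    (hm : ∀ i ∈ Finset.range r, 2 ≤ m i)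
    (h : 2 < ∑ i ∈ Finset.range r, (1 - 1 / (m i : ℚ))) :
    2 + 1 / 42 ≤ ∑ i ∈ Finset.range r, (1 - 1 / (m i : ℚ)) := by
  have hr : 2 < r := by exact_mod_cast h.trans_le (sum_one_sub_one_div_le r m)
  rcases le_or_gt 5 r with h₅ | h₅
  · have h₅' : (5 : ℚ) ≤ r := by exact_mod_cast h₅
    linarith [half_mul_le_sum_one_sub_one_div hm]
  have hm' : ∀ i < r, 2 ≤ m i := fun i hi ↦ hm i (Finset.mem_range.2 hi)
  interval_cases r
  · simp only [Finset.sum_range_succ, Finset.sum_range_zero] at h ⊢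
    linarith [one_div_add_one_div_add_one_div_le (hm' 0 (by norm_num)) (hm' 1 (by norm_num))
      (hm' 2 (by norm_num)) (by linarith)]
  · simp only [Finset.sum_range_succ, Finset.sum_range_zero] at h ⊢
    rcases one_div_natCast_eq_half_or_le_third (hm' 0 (by norm_num)) with h₀ | h₀ <;>
    rcases one_div_natCast_eq_half_or_le_third (hm' 1 (by norm_num)) with h₁ | h₁ <;>
    rcases one_div_natCast_eq_half_or_le_third (hm' 2 (by norm_num)) with h₂ | h₂ <;>
    rcases one_div_natCast_eq_half_or_le_third (hm' 3 (by norm_num)) with h₃ | h₃ <;>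
    linarith

theorem one_div_42_le_of_pos (g₀ : ℕ) {r : ℕ} {m : ℕ → ℕ}
    (hm : ∀ i ∈ Finset.range r, 2 ≤ m i)
    (h : 0 < 2 * (g₀ : ℚ) - 2 + ∑ i ∈ Finset.range r, (1 - 1 / (m i : ℚ))) :
    1 / 42 ≤ 2 * (g₀ : ℚ) - 2 + ∑ i ∈ Finset.range r, (1 - 1 / (m i : ℚ)) := by
  have hS := half_mul_le_sum_one_sub_one_div hm
  have hr₀ : (0 : ℚ) ≤ r := r.cast_nonneg
  rcases g₀ with _ | _ | k
  · push_cast at h ⊢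
    linarith [le_sum_one_sub_one_div_of_two_lt hm (by linarith)]
  · push_cast at h ⊢
    have hr : (0 : ℚ) < r := by linarith [sum_one_sub_one_div_le r m]
    have hr' : (1 : ℚ) ≤ r := by exact_mod_cast hr
    linarith
  · push_cast
    linarith [(k.cast_nonneg : (0 : ℚ) ≤ k)]

/-- **Hurwitz bound (arithmetic form).** If `g ≥ 2`, `n ≥ 1`, `g₀ ≥ 0`, `r ≥ 0` and
`m 0, ..., m (r-1) ≥ 2` satisfy the Riemann–Hurwitz equation
`2g - 2 = n (2g₀ - 2) + n Σᵢ (1 - 1/mᵢ)` (as rational numbers), then `n ≤ 84 (g - 1)`. -/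
theorem hurwitz_bound
    (g n g₀ r : ℕ) (hg : 2 ≤ g) (hn : 1 ≤ n)
    (m : ℕ → ℕ) (hm : ∀ i ∈ Finset.range r, 2 ≤ m i)
    (hRH : 2 * (g : ℚ) - 2 =
      n * (2 * (g₀ : ℚ) - 2) + n * ∑ i ∈ Finset.range r, (1 - 1 / (m i : ℚ))) :
    n ≤ 84 * (g - 1) := by
  have hg' : (2 : ℚ) ≤ g := by exact_mod_cast hg
  have hn' : (0 : ℚ) < n := by exact_mod_cast hn
  rw [← mul_add] at hRH
  have hδ := one_div_42_le_of_pos g₀ hm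
    (pos_of_mul_pos_right (by linarith : 0 < (n : ℚ) * _) hn'.le)
  have hle := mul_le_mul_of_nonneg_left hδ hn'.le
  have key : (n : ℚ) ≤ 84 * ((g : ℚ) - 1) := by linarith
  rw [← Nat.cast_one, ← Nat.cast_sub (by omega : 1 ≤ g)] at key
  exact_mod_cast key
end

section
/- Let g ≥ 2 and g_0 ≥ 0, r ≥ 0 be integers, let G be a finite cyclic group of order N, and suppose there are elements c_1, ..., c_r in G with c_1 · c_2 · ... · c_r = 1 such that each c_i has order m_i ≥ 2, such that c_1, ..., c_r generate G in case g_0 = 0, and such that the Riemann–Hurwitz equation 2g − 2 = N(2g_0 − 2) + N·Σ_{i=1}^{r} (1 − 1/m_i) holds (as rational numbers). Then N ≤ 2(2g + 1). -/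
/-- If elements of a cyclic group have product `1` and generate it, then the group order divides
every common multiple of the orders of all but one of them. -/
theorem card_dvd_of_forall_ne_orderOf_dvd {G : Type*} [CommGroup G] [Fintype G] [IsCyclic G]
    {r : ℕ} {c : Fin r → G} (hprod : ∏ i, c i = 1)
    (hgen : Subgroup.closure (Set.range c) = ⊤) (i : Fin r) {L : ℕ}
    (h : ∀ j, j ≠ i → orderOf (c j) ∣ L) : Fintype.card G ∣ L := by
  have hpow : ∀ j, j ≠ i → c j ^ L = 1 := fun j hj => orderOf_dvd_iff_pow_eq_one.mp (h j hj)
  have hi : c i ^ L = 1 := by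
    rw [← Finset.prod_eq_single_of_mem (f := fun j => c j ^ L) i (Finset.mem_univ i)
      (fun j _ hj => hpow j hj), Finset.prod_pow, hprod, one_pow]
  have hle : Subgroup.closure (Set.range c) ≤ (powMonoidHom L : G →* G).ker := by
    rw [Subgroup.closure_le]
    rintro _ ⟨j, rfl⟩
    by_cases hj : j = i
    · subst hj
      exact hi
    · exact hpow j hj
  obtain ⟨a, ha⟩ := IsCyclic.exists_ofOrder_eq_natCard (α := G)
  rw [← Nat.card_eq_fintype_card, ← ha]
  exact orderOf_dvd_of_pow_eq_one (hle (hgen ▸ Subgroup.mem_top a))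

theorem coprime_of_forall_common_multiple {N a b x y : ℕ} (hN : 0 < N) (ha : a * x = N)
    (hb : b * y = N) (h : ∀ L, a ∣ L → b ∣ L → N ∣ L) : Nat.Coprime x y := by
  obtain ⟨x', hx⟩ := Nat.gcd_dvd_left x y
  obtain ⟨y', hy⟩ := Nat.gcd_dvd_right x y
  rw [Nat.coprime_iff_gcd_eq_one]
  set d := Nat.gcd x y
  have hax : a * x' * d = N := by rw [← ha, hx]; ring
  have hby : b * y' * d = N := by rw [← hb, hy]; ring
  have hd : 0 < d := Nat.pos_of_ne_zero fun h0 => by simp [h0] at hax; omega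
  have hL : a * x' = b * y' := Nat.eq_of_mul_eq_mul_right hd (hax.trans hby.symm)
  have hdvd : N ∣ a * x' := h _ ⟨x', rfl⟩ ⟨y', hL⟩
  have hpos : 0 < a * x' := Nat.pos_of_mul_pos_right (hax ▸ hN)
  have hle := Nat.le_of_dvd hpos hdvd
  nlinarith

theorem two_mul_add_le_of_two_le {N k x y z : ℕ} (hN : k * x = N) (hk : 2 ≤ k) (hx : 2 ≤ x)
    (hy : y ∣ N) (hz : z ∣ N) (hxy : Nat.Coprime x y) (hxz : Nat.Coprime x z)
    (hyz : Nat.Coprime y z) : 2 * (x + y + z) ≤ N + 6 := by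
  subst hN
  have hyk : y ∣ k := hxy.symm.dvd_of_dvd_mul_right hy
  have hzk : z ∣ k := hxz.symm.dvd_of_dvd_mul_right hz
  have hle : y * z ≤ k := Nat.le_of_dvd (by omega) (hyz.mul_dvd_of_dvd_of_dvd hyk hzk)
  have hy0 : 0 < y := Nat.pos_of_dvd_of_pos hyk (by omega)
  have hz0 : 0 < z := Nat.pos_of_dvd_of_pos hzk (by omega)
  obtain ⟨k, rfl⟩ := Nat.exists_eq_add_of_le hk
  obtain ⟨x, rfl⟩ := Nat.exists_eq_add_of_le hx
  obtain ⟨y, rfl⟩ := Nat.exists_eq_add_of_le hy0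
  obtain ⟨z, rfl⟩ := Nat.exists_eq_add_of_le hz0
  nlinarith [Nat.zero_le (k * x), Nat.zero_le (y * z)]

/-- Pairwise coprime proper divisors `x, y, z` of `N` satisfy `2 (x + y + z) ≤ N + 6`. -/
theorem two_mul_add_le_of_pairwise_coprime {N a b c x y z : ℕ} (hN : 0 < N)
    (ha : a * x = N) (hb : b * y = N) (hc : c * z = N)
    (ha2 : 2 ≤ a) (hb2 : 2 ≤ b) (hc2 : 2 ≤ c) (hxy : Nat.Coprime x y) (hxz : Nat.Coprime x z)
    (hyz : Nat.Coprime y z) : 2 * (x + y + z) ≤ N + 6 := by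
  have hx : x ∣ N := Dvd.intro_left a ha
  have hy : y ∣ N := Dvd.intro_left b hb
  have hz : z ∣ N := Dvd.intro_left c hc
  by_cases hx2 : 2 ≤ x
  · exact two_mul_add_le_of_two_le ha ha2 hx2 hy hz hxy hxz hyz
  by_cases hy2 : 2 ≤ y
  · have := two_mul_add_le_of_two_le hb hb2 hy2 hx hz hxy.symm hyz hxz
    omega
  by_cases hz2 : 2 ≤ z
  · have := two_mul_add_le_of_two_le hc hc2 hz2 hx hy hxz.symm hyz.symm hxy
    omega
  omega


/-- **Wiman's bound.** Let `g ≥ 2`, `g₀ ≥ 0`, `r ≥ 0` and let `G` be a finite cyclic group of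
order `N` admitting elements `c 0, ..., c (r-1)` with product `1`, with `orderOf (c i) = m i ≥ 2`,
generating `G` in case `g₀ = 0`, and satisfying the Riemann–Hurwitz equation
`2g - 2 = N (2g₀ - 2) + N Σᵢ (1 - 1/mᵢ)`.  Then `N ≤ 2 (2g + 1)`. -/
theorem wiman_bound
    (g g₀ r N : ℕ) (hg : 2 ≤ g)
    (G : Type*) [Group G] [Fintype G] (hcyc : IsCyclic G) (hN : Fintype.card G = N)
    (m : Fin r → ℕ) (hm : ∀ i, 2 ≤ m i)
    (c : Fin r → G) (horder : ∀ i, orderOf (c i) = m i)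
    (hprod : (List.ofFn c).prod = 1)
    (hgen : g₀ = 0 → Subgroup.closure (Set.range c) = ⊤)
    (hRH : 2 * (g : ℚ) - 2 =
      N * (2 * (g₀ : ℚ) - 2) + N * ∑ i, (1 - 1 / (m i : ℚ))) :
    N ≤ 2 * (2 * g + 1) := by
  have hcommon : g₀ = 0 → ∀ i L, (∀ j, j ≠ i → m j ∣ L) → N ∣ L := by
    intro h0 i L h
    let _ : CommGroup G := IsCyclic.commGroup
    rw [← hN]
    refine card_dvd_of_forall_ne_orderOf_dvd (c := c) ?_ (hgen h0) i
      (fun j hj => (horder j) ▸ h j hj)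
    rw [← List.prod_ofFn]
    exact hprod
  have hN0 : 0 < N := hN ▸ Fintype.card_pos
  have hNq : (0 : ℚ) < N := by exact_mod_cast hN0
  have hgq : (2 : ℚ) ≤ g := by exact_mod_cast hg
  have hinv : ∀ i, ∀ k : ℕ, 0 < k → k ≤ m i → 1 / (m i : ℚ) ≤ 1 / k := fun i k hk hki =>
    one_div_le_one_div_of_le (by exact_mod_cast hk) (by exact_mod_cast hki)
  have hhalf : ∀ i, 1 / (m i : ℚ) ≤ 1 / 2 := fun i => by exact_mod_cast hinv i 2 two_pos (hm i)
  have hsum : (r : ℚ) / 2 ≤ ∑ i, (1 - 1 / (m i : ℚ)) := by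
    calc (r : ℚ) / 2 = ∑ _i : Fin r, (1 / 2 : ℚ) := by simp [div_eq_mul_inv]
      _ ≤ _ := Finset.sum_le_sum fun i _ => by linarith [hhalf i]
  have hlarge : (1 / 2 : ℚ) ≤ 2 * g₀ - 2 + ∑ i, (1 - 1 / (m i : ℚ)) →
      N ≤ 2 * (2 * g + 1) := by
    intro h
    have : (N : ℚ) ≤ 2 * (2 * g + 1) := by nlinarith
    exact_mod_cast this
  rcases Nat.eq_zero_or_pos g₀ with h0 | h0
  · replace hcommon := hcommon h0
    subst h0
    by_cases hr5 : 5 ≤ r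
    · have : (5 : ℚ) ≤ r := by exact_mod_cast hr5
      exact hlarge (by push_cast; linarith)
    have hr3 : 2 < r := by
      by_contra hr
      have hrq : (r : ℚ) ≤ 2 := by exact_mod_cast not_lt.mp hr
      have : ∑ i, (1 - 1 / (m i : ℚ)) ≤ r := by
        calc _ ≤ ∑ _i : Fin r, (1 : ℚ) := Finset.sum_le_sum fun i _ => by
              linarith [show (0 : ℚ) ≤ 1 / m i by positivity]
          _ = r := by simp
      push_cast at hRH
      nlinarith
    have hr : r = 3 ∨ r = 4 := by omega
    rcases hr with rfl | rfl
    · have hdvd : ∀ i, ∃ x, m i * x = N := fun i => by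
        obtain ⟨x, hx⟩ : m i ∣ N := hN ▸ horder i ▸ orderOf_dvd_card
        exact ⟨x, hx.symm⟩
      choose x hx using hdvd
      have hcop : ∀ i j k : Fin 3, (∀ l, l ≠ k → l = i ∨ l = j) → Nat.Coprime (x i) (x j) :=
        fun i j k h => coprime_of_forall_common_multiple hN0 (hx i) (hx j) fun L hi hj =>
          hcommon k L fun l hl => by rcases h l hl with rfl | rfl <;> assumption
      have hle := two_mul_add_le_of_pairwise_coprime hN0 (hx 0) (hx 1) (hx 2) (hm 0) (hm 1) (hm 2)
        (hcop 0 1 2 (by decide)) (hcop 0 2 1 (by decide)) (hcop 1 2 0 (by decide))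
      have hxq : ∀ i, (N : ℚ) * (1 / (m i : ℚ)) = x i := fun i => by
        have : (m i : ℚ) ≠ 0 := by exact_mod_cast (show m i ≠ 0 by have := hm i; omega)
        rw [← hx i]
        push_cast
        field_simp
      rw [Fin.sum_univ_three] at hRH
      have hleq : 2 * ((x 0 : ℚ) + x 1 + x 2) ≤ N + 6 := by exact_mod_cast hle
      have : (N : ℚ) ≤ 2 * (2 * g + 1) := by
        push_cast at hRH
        linarith [hxq 0, hxq 1, hxq 2]
      exact_mod_cast this
    · by_cases h : ∃ i, ∀ j, j ≠ i → m j ≤ 3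
      · obtain ⟨i, hi⟩ := h
        have h6 : N ∣ 6 := hcommon i 6 fun j hj => by
          have h3 := hi j hj
          have h2 := hm j
          interval_cases m j <;> decide
        have := Nat.le_of_dvd (by norm_num) h6
        omega
      · push Not at h
        obtain ⟨j, -, hj⟩ := h 0
        obtain ⟨k, hkj, hk⟩ := h j
        apply hlarge
        have hj4 : 1 / (m j : ℚ) ≤ 1 / 4 := by exact_mod_cast hinv j 4 (by norm_num) hj
        have hk4 : 1 / (m k : ℚ) ≤ 1 / 4 := by exact_mod_cast hinv k 4 (by norm_num) hk
        rw [Fin.sum_univ_four]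
        have h0 := hhalf 0
        have h1 := hhalf 1
        have h2 := hhalf 2
        have h3 := hhalf 3
        push_cast
        clear hRH hsum hlarge
        fin_cases j <;> fin_cases k <;> simp at hkj <;>
          simp only [Fin.zero_eta, Fin.mk_one, Fin.reduceFinMk] at hj4 hk4 <;> linarith
  · have h0q : (1 : ℚ) ≤ g₀ := by exact_mod_cast h0
    rcases Nat.eq_zero_or_pos r with rfl | hr
    · rcases Nat.lt_or_ge 1 g₀ with h1 | h1
      · have : (2 : ℚ) ≤ g₀ := by exact_mod_cast h1
        exact hlarge (by simp; linarith)
      · have : g₀ = 1 := by omega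
        subst this
        simp at hRH
        linarith
    · have : (1 : ℚ) ≤ r := by exact_mod_cast hr
      exact hlarge (by linarith)
end

section
/- Let k be a field, let n ≥ 2 and t ≥ 1 be integers, let a_1, ..., a_t ∈ k be pairwise distinct, and let n_1, ..., n_t be integers with 0 < n_i < n for each i and gcd(n_1, ..., n_t) = 1. Then the polynomial y^n − (x − a_1)^{n_1} · ... · (x − a_t)^{n_t} is irreducible as a polynomial in y over the rational function field k(x). -/
open Polynomial

/-- If an irreducible polynomial `g` divides `X ^ n - C f`, then `f ^ g.natDegree` is an
`n`-th power: the norm of a root of `g` is an `n`-th root of it. -/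
theorem exists_pow_eq_pow_natDegree_of_dvd {K : Type*} [Field K] {n : ℕ} {f : K}
    {g : Polynomial K} (hg : Irreducible g) (hdvd : g ∣ X ^ n - Polynomial.C f) :
    ∃ c : K, c ^ n = f ^ g.natDegree := by
  have : Fact (Irreducible g) := ⟨hg⟩
  refine ⟨Algebra.norm K (AdjoinRoot.root g), ?_⟩
  have hroot : AdjoinRoot.root g ^ n = algebraMap K (AdjoinRoot g) f := by
    have h := AdjoinRoot.mk_eq_zero.mpr hdvd
    rw [map_sub, map_pow, AdjoinRoot.mk_X, AdjoinRoot.mk_C, sub_eq_zero] at h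
    exact h
  rw [← map_pow, hroot, Algebra.norm_algebraMap, (AdjoinRoot.powerBasis hg.ne_zero).finrank,
    AdjoinRoot.powerBasis_dim]

/-- If every irreducible factor of `X ^ n - C f` has degree divisible by `n`, then
`X ^ n - C f` is irreducible. -/
theorem irreducible_X_pow_sub_C_of_dvd_natDegree {K : Type*} [Field K] {n : ℕ} (hn : 0 < n)
    {f : K} (h : ∀ g : Polynomial K, Irreducible g → g ∣ X ^ n - Polynomial.C f →
      n ∣ g.natDegree) :
    Irreducible (X ^ n - Polynomial.C f) := by
  have hdeg : (X ^ n - Polynomial.C f).natDegree = n := natDegree_X_pow_sub_C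
  have h0 : X ^ n - Polynomial.C f ≠ 0 := X_pow_sub_C_ne_zero hn f
  obtain ⟨g, hg, hdvd⟩ := exists_irreducible_of_natDegree_pos (hdeg.symm ▸ hn)
  have hle := Nat.le_of_dvd hg.natDegree_pos (h g hg hdvd)
  exact (associated_of_dvd_of_natDegree_le hdvd h0 (hdeg.trans_le hle)).irreducible hg

/-- If a power `f ^ d` of a polynomial is an `n`-th power in the rational function field, then
`n` divides `d` times the multiplicity of each root of `f`. -/
theorem dvd_mul_rootMultiplicity_of_ratFunc_pow_eq {k : Type*} [Field k] {n d : ℕ}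
    {f : Polynomial k} (hf : f ≠ 0) {c : RatFunc k}
    (hc : c ^ n = algebraMap (Polynomial k) (RatFunc k) f ^ d) (a : k) :
    n ∣ d * f.rootMultiplicity a := by
  classical
  have hq : c.denom ≠ 0 := c.denom_ne_zero
  have hpoly : c.num ^ n = f ^ d * c.denom ^ n := by
    apply RatFunc.algebraMap_injective k
    have hq' : algebraMap (Polynomial k) (RatFunc k) c.denom ≠ 0 :=
      RatFunc.algebraMap_ne_zero hq
    rw [map_mul, map_pow, map_pow, map_pow, ← hc, ← mul_pow]
    congr 1
    exact (div_eq_iff hq').mp c.num_div_denom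
  have hmult := congrArg (fun p => p.roots.count a) hpoly
  simp only [roots_mul (mul_ne_zero (pow_ne_zero d hf) (pow_ne_zero n hq)), roots_pow,
    Multiset.count_add, Multiset.count_nsmul, count_roots] at hmult
  exact (Nat.dvd_add_left (dvd_mul_right n _)).mp (hmult ▸ dvd_mul_right n _)

theorem rootMultiplicity_prod_X_sub_C_pow {k ι : Type*} [Field k] [Fintype ι] {a : ι → k}
    (ha : Function.Injective a) (e : ι → ℕ) (i : ι) :
    (∏ j, (X - Polynomial.C (a j)) ^ e j).rootMultiplicity (a i) = e i := by
  classical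
  rw [← count_roots, roots_prod _ _ (Finset.prod_ne_zero_iff.mpr fun j _ =>
    pow_ne_zero _ (X_sub_C_ne_zero (a j)))]
  simp [Multiset.count_bind, Multiset.count_singleton, ha.eq_iff]

/-- **Irreducibility of superelliptic equations.** Let `k` be a field, `n ≥ 2`, `t ≥ 1`,
let `a 0, ..., a (t-1) ∈ k` be pairwise distinct and let `e 0, ..., e (t-1)` be integers with
`0 < e i < n` and `gcd (e 0, ..., e (t-1)) = 1`.  Then
`y^n - (x - a 0)^(e 0) ⋯ (x - a (t-1))^(e (t-1))` is irreducible as a polynomial in `y` over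
the rational function field `k(x)`. -/
theorem superelliptic_irreducible
    (k : Type*) [Field k] (n t : ℕ) (hn : 2 ≤ n) (ht : 1 ≤ t)
    (a : Fin t → k) (ha : Function.Injective a)
    (e : Fin t → ℕ) (he : ∀ i, 0 < e i ∧ e i < n)
    (hgcd : Finset.univ.gcd e = 1) :
    Irreducible
      ((X : Polynomial (RatFunc k)) ^ n -
        Polynomial.C (∏ i : Fin t, (RatFunc.X - RatFunc.C (a i)) ^ e i)) := by
  have hf : ∏ i : Fin t, (X - Polynomial.C (a i)) ^ e i ≠ 0 :=
    Finset.prod_ne_zero_iff.mpr fun i _ => pow_ne_zero _ (X_sub_C_ne_zero (a i))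
  have hmap : ∏ i : Fin t, (RatFunc.X - RatFunc.C (a i)) ^ e i =
      algebraMap (Polynomial k) (RatFunc k) (∏ i : Fin t, (X - Polynomial.C (a i)) ^ e i) := by
    simp [map_prod]
  refine irreducible_X_pow_sub_C_of_dvd_natDegree (by omega) fun g hg hdvd => ?_
  obtain ⟨c, hc⟩ := exists_pow_eq_pow_natDegree_of_dvd hg hdvd
  rw [hmap] at hc
  have hgcd_mul : n ∣ Finset.univ.gcd fun i => g.natDegree * e i :=
    Finset.dvd_gcd fun i _ => by
      simpa only [rootMultiplicity_prod_X_sub_C_pow ha e i] using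
        dvd_mul_rootMultiplicity_of_ratFunc_pow_eq hf hc (a i)
  simpa [Finset.gcd_mul_left, hgcd] using hgcd_mul
end

section
/- Let p be a prime, q = p^f, and let k be an algebraically closed field of characteristic p containing the finite field F_q. Let G be the group of k-algebra automorphisms of the rational function field k(x) of the form x ↦ (ax + b)/(cx + d) with (a b; c d) ∈ GL(2, F_q); G is isomorphic to PGL(2, q). Then the fixed field of G is k(z), where z = ((x^q − x)^{q−1} + 1)^{q+1} / (x^q − x)^{q(q−1)}. -/
open Polynomial IntermediateField

/-- The value at `x` of the rational function generating the `PGL(2,q)`-invariants. -/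
def pglInvariant {K : Type*} [Field K] (q : ℕ) (x : K) : K :=
  ((x ^ q - x) ^ (q - 1) + 1) ^ (q + 1) / (x ^ q - x) ^ (q * (q - 1))

section Invariance

variable {K : Type*} [Field K] {p : ℕ} [Fact p.Prime] [CharP K p] {f q : ℕ}

theorem pglInvariant_eq_div (hq : q = p ^ f) {x : K} (hx : x ^ q - x ≠ 0) :
    pglInvariant q x = (x ^ q ^ 2 - x) ^ (q + 1) / (x ^ q - x) ^ (q ^ 2 + 1) := by
  have hq0 : 1 ≤ q := hq ▸ Nat.one_le_pow _ _ (Fact.out : p.Prime).pos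
  have hv : x ^ q ^ 2 - x = ((x ^ q - x) ^ (q - 1) + 1) * (x ^ q - x) := by
    have h : (x ^ q - x) ^ q = x ^ q ^ 2 - x ^ q := by
      rw [sq, pow_mul]
      subst hq
      exact sub_pow_char_pow (x ^ p ^ f) x f
    rw [add_mul, one_mul, pow_sub_one_mul (by lia), h]
    ring
  have he : q ^ 2 + 1 = q * (q - 1) + (q + 1) := by
    obtain ⟨n, rfl⟩ := Nat.exists_eq_add_of_le' hq0
    rw [Nat.add_sub_cancel]
    ring
  rw [pglInvariant, hv, mul_pow, he, pow_add (x ^ q - x) (q * (q - 1)),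
    mul_div_mul_right _ _ (pow_ne_zero _ hx)]

theorem mobius_pow_sub_self {r n : ℕ} (hr : r = p ^ n) {x a b c d : K} (ha : a ^ r = a)
    (hb : b ^ r = b) (hc : c ^ r = c) (hd : d ^ r = d) (hj : c * x + d ≠ 0) :
    ((a * x + b) / (c * x + d)) ^ r - (a * x + b) / (c * x + d) =
      (a * d - b * c) * (x ^ r - x) / (c * x + d) ^ (r + 1) := by
  have h (y z : K) : (y + z) ^ r = y ^ r + z ^ r := by
    subst hr
    exact add_pow_char_pow y z p n
  have hj' : c * x ^ r + d = (c * x + d) ^ r := by rw [h, mul_pow, hc, hd]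
  have hj'' : c * x ^ r + d ≠ 0 := hj' ▸ pow_ne_zero _ hj
  rw [div_pow, pow_succ, ← hj', h, mul_pow, ha, hb, div_sub_div _ _ hj'' hj]
  congr 1
  ring

theorem pglInvariant_mobius (hq : q = p ^ f) {x a b c d : K} (ha : a ^ q = a)
    (hb : b ^ q = b) (hc : c ^ q = c) (hd : d ^ q = d) (hdet : a * d - b * c ≠ 0)
    (hj : c * x + d ≠ 0) (hx : x ^ q - x ≠ 0) :
    pglInvariant q ((a * x + b) / (c * x + d)) = pglInvariant q x := by
  have hsq {y : K} (hy : y ^ q = y) : y ^ q ^ 2 = y := by rw [sq, pow_mul, hy, hy]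
  have hD : (a * d - b * c) ^ q = a * d - b * c := by
    have h : (a * d - b * c) ^ q = (a * d) ^ q - (b * c) ^ q := by
      subst hq
      exact sub_pow_char_pow (a * d) (b * c) f
    rw [h, mul_pow, mul_pow, ha, hb, hc, hd]
  have h₁ := mobius_pow_sub_self hq ha hb hc hd hj
  have h₂ := mobius_pow_sub_self (r := q ^ 2) (n := f * 2) (by rw [hq, pow_mul])
    (hsq ha) (hsq hb) (hsq hc) (hsq hd) hj
  rw [pglInvariant_eq_div hq hx, pglInvariant_eq_div hq (by
    rw [h₁]
    exact div_ne_zero (mul_ne_zero hdet hx) (pow_ne_zero _ hj)), h₁, h₂]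
  rw [div_pow, div_pow, ← pow_mul, ← pow_mul, mul_comm (q ^ 2 + 1) (q + 1),
    div_div_div_cancel_right₀ (pow_ne_zero _ hj), mul_pow, mul_pow, pow_succ _ q, pow_succ _ (q ^ 2),
    hD, hsq hD, mul_div_mul_left _ _ (mul_ne_zero hdet hdet)]

end Invariance

namespace RatFunc

variable {k : Type*} [Field k]

theorem algebraMap_C_mul_X_add_C (c d : k) :
    algebraMap k[X] (RatFunc k) (Polynomial.C c * Polynomial.X + Polynomial.C d) =
      C c * X + C d := by
  simp

theorem C_mul_X_add_C_ne_zero {c d : k} (h : c ≠ 0 ∨ d ≠ 0) : C c * X + C d ≠ 0 := by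
  rw [← algebraMap_C_mul_X_add_C]
  refine algebraMap_ne_zero fun h0 => ?_
  have h₀ := congrArg (coeff · 0) h0
  have h₁ := congrArg (coeff · 1) h0
  simp [coeff_C] at h₀ h₁
  tauto

theorem mobius_ne_C {a b c d : k} (h : a * d - b * c ≠ 0) (e : k) :
    (C a * X + C b) / (C c * X + C d) ≠ C e := by
  have hj : C c * X + C d ≠ 0 := C_mul_X_add_C_ne_zero (by
    by_contra! h0
    simp [h0.1, h0.2] at h)
  intro he
  rw [div_eq_iff hj] at he
  have h0 : C (a - e * c) * X + C (b - e * d) = 0 := by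
    simp only [map_sub, map_mul]
    linear_combination he
  have h1 : a - e * c = 0 ∧ b - e * d = 0 := by
    by_contra h2
    exact C_mul_X_add_C_ne_zero (by tauto) h0
  exact h (by linear_combination d * h1.1 - c * h1.2)

theorem exists_algEquiv_mobius {a b c d : k} (h : a * d - b * c ≠ 0) :
    ∃ φ : RatFunc k ≃ₐ[k] RatFunc k, φ X = (C a * X + C b) / (C c * X + C d) := by
  set t : RatFunc k := (C a * X + C b) / (C c * X + C d) with ht
  have hj : C c * X + C d ≠ 0 := C_mul_X_add_C_ne_zero (by
    by_contra! h0
    simp [h0.1, h0.2] at h)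
  have htr : Transcendental k t :=
    transcendental_of_ne_C t fun ⟨e, he⟩ => mobius_ne_C h e he
  have hinj : Function.Injective (aeval t : k[X] →ₐ[k] RatFunc k) :=
    transcendental_iff_injective.mp htr
  let σ : RatFunc k →ₐ[k] RatFunc k := liftAlgHom (aeval t)
    (nonZeroDivisors_le_comap_nonZeroDivisors_of_injective _ hinj)
  have hσ : σ X = t := by
    have := liftAlgHom_apply_div (aeval t : k[X] →ₐ[k] RatFunc k)
      (nonZeroDivisors_le_comap_nonZeroDivisors_of_injective _ hinj) Polynomial.X 1
    simpa [σ] using this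
  have hC (e : k) : C e ∈ σ.fieldRange := σ.fieldRange.algebraMap_mem e
  have htσ : t ∈ σ.fieldRange := ⟨X, hσ⟩
  have hX : X ∈ σ.fieldRange := by
    have hdet : C a * C d - C b * C c ≠ 0 := by
      simpa only [← map_mul, ← map_sub, ne_eq, map_eq_zero] using h
    have h1 : C a - C c * t = (C a * C d - C b * C c) / (C c * X + C d) := by
      rw [ht]
      field_simp
      ring
    have h2 : (X : RatFunc k) = (C d * t - C b) / (C a - C c * t) := by
      have ht' : t * (C c * X + C d) = C a * X + C b := div_mul_cancel₀ _ hj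
      rw [eq_div_iff (h1 ▸ div_ne_zero hdet hj)]
      linear_combination -ht'
    rw [h2]
    exact div_mem (sub_mem (mul_mem (hC d) htσ) (hC b)) (sub_mem (hC a) (mul_mem (hC c) htσ))
  have htop : σ.fieldRange = ⊤ :=
    top_le_iff.mp (adjoin_X (K := k) ▸ adjoin_simple_le_iff.mpr hX)
  exact ⟨AlgEquiv.ofBijective σ ⟨σ.injective, AlgHom.fieldRange_eq_top.mp htop⟩, hσ⟩

/-- The Möbius transformations, sorted by the image of `∞`: `e X + d` sends `∞` to `∞`, and
`a + e / (X + d)` sends `∞` to `a`. -/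
noncomputable def mobiusNormalForm : Option k × k × k → RatFunc k
  | (none, e, d) => C e * X + C d
  | (some a, e, d) => (C a * X + C (a * d + e)) / (C 1 * X + C d)

theorem quadratic_eq_zero {a b c : k} (h : C a * X ^ 2 + C b * X + C c = 0) :
    a = 0 ∧ b = 0 ∧ c = 0 := by
  have h' : (Polynomial.C a * Polynomial.X ^ 2 + Polynomial.C b * Polynomial.X +
      Polynomial.C c : k[X]) = 0 := algebraMap_injective k (by simpa using h)
  refine ⟨?_, ?_, ?_⟩
  · simpa [coeff_X, coeff_C] using congrArg (coeff · 2) h'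
  · simpa [coeff_X_pow, coeff_C] using congrArg (coeff · 1) h'
  · simpa using congrArg (coeff · 0) h'

theorem mobiusNormalForm_some_ne_none {a e d e' d' : k} (he' : e' ≠ 0) :
    mobiusNormalForm (some a, e, d) ≠ mobiusNormalForm (none, e', d') := by
  intro h
  rw [mobiusNormalForm, mobiusNormalForm, div_eq_iff (C_mul_X_add_C_ne_zero (by simp))] at h
  refine he' (quadratic_eq_zero (b := d' + e' * d - a) (c := d' * d - (a * d + e)) ?_).1
  simp only [map_sub, map_add, map_mul, map_one] at h ⊢
  linear_combination -h

theorem mobiusNormalForm_injOn :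
    Set.InjOn (mobiusNormalForm (k := k)) {s | s.2.1 ≠ 0} := by
  rintro ⟨_ | a, e, d⟩ he ⟨_ | a', e', d'⟩ he' h
  · rw [mobiusNormalForm, mobiusNormalForm] at h
    have h0 := quadratic_eq_zero (a := 0) (b := e - e') (c := d - d') (by
      simp only [map_sub, map_zero]
      linear_combination h)
    simp [sub_eq_zero.mp h0.2.1, sub_eq_zero.mp h0.2.2]
  · exact absurd h.symm (mobiusNormalForm_some_ne_none he)
  · exact absurd h (mobiusNormalForm_some_ne_none he')
  · rw [mobiusNormalForm, mobiusNormalForm,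
      div_eq_div_iff (C_mul_X_add_C_ne_zero (by simp)) (C_mul_X_add_C_ne_zero (by simp))] at h
    have h0 := quadratic_eq_zero (a := a - a') (b := a * d' + (a * d + e) - a' * d - (a' * d' + e'))
      (c := (a * d + e) * d' - (a' * d' + e') * d) (by
        simp only [map_sub, map_add, map_mul, map_one] at h ⊢
        linear_combination h)
    obtain rfl : a = a' := sub_eq_zero.mp h0.1
    obtain rfl : e = e' := by linear_combination h0.2.1
    obtain rfl : d = d' := by
      have h1 : e * (d' - d) = 0 := by linear_combination h0.2.2
      exact (sub_eq_zero.mp ((mul_eq_zero.mp h1).resolve_left he)).symm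
    rfl

end RatFunc

theorem card_pow_eq_self (k : Type*) [Field k] [IsAlgClosed k] (p : ℕ) [Fact p.Prime] [CharP k p]
    {f q : ℕ} (hf : 1 ≤ f) (hq : q = p ^ f) : Nat.card {a : k // a ^ q = a} = q := by
  have hq1 : 1 < q := hq ▸ Nat.one_lt_pow (by lia) (Fact.out : p.Prime).one_lt
  have hsep : (X ^ q - X : k[X]).Separable :=
    galois_poly_separable p q (hq ▸ dvd_pow_self p (by lia))
  have hcard := card_rootSet_eq_natDegree (K := k) hsep (IsAlgClosed.splits _)
  rw [FiniteField.X_pow_card_sub_X_natDegree_eq k hq1] at hcard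
  rw [← Nat.card_eq_fintype_card] at hcard
  refine Eq.trans ?_ hcard
  refine Nat.card_congr (Equiv.subtypeEquivRight fun a => ?_)
  simp [mem_rootSet, FiniteField.X_pow_card_sub_X_ne_zero k hq1, sub_eq_zero]

/-- There are `q (q - 1) (q + 1)` normal forms with coefficients in `F_q`. -/
theorem card_mobius_parameters (k : Type*) [Field k] [IsAlgClosed k] (p : ℕ) [Fact p.Prime]
    [CharP k p] {f q : ℕ} (hf : 1 ≤ f) (hq : q = p ^ f) :
    Nat.card (Option {a : k // a ^ q = a} × {e : {a : k // a ^ q = a} // e.1 ≠ 0} ×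
      {a : k // a ^ q = a}) = q * (q - 1) * (q + 1) := by
  have hq0 : q ≠ 0 := by
    rw [hq]
    exact pow_ne_zero _ (Fact.out : p.Prime).ne_zero
  have hcard := card_pow_eq_self k p hf hq
  have : Finite {a : k // a ^ q = a} := Nat.finite_of_card_ne_zero (by rwa [hcard])
  have hne : Nat.card {e : {a : k // a ^ q = a} // e.1 ≠ 0} = q - 1 := by
    have h := Set.ncard_add_ncard_compl {(⟨0, zero_pow hq0⟩ : {a : k // a ^ q = a})}
    rw [Set.ncard_singleton, hcard] at h
    have hset : ({⟨0, zero_pow hq0⟩}ᶜ : Set {a : k // a ^ q = a}) = {e | e.1 ≠ 0} := by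
      ext e
      simp [Subtype.ext_iff]
    rw [hset] at h
    exact Nat.eq_sub_of_add_eq' h
  rw [Nat.card_prod, Nat.card_prod, Finite.card_option, hne, hcard]
  ring

theorem finrank_adjoin_pglInvariant_X (k : Type*) [Field k] {q : ℕ} (hq : 1 < q) :
    Module.finrank k⟮pglInvariant q (RatFunc.X : RatFunc k)⟯ (RatFunc k) ≤ q * (q - 1) * (q + 1) ∧
      0 < Module.finrank k⟮pglInvariant q (RatFunc.X : RatFunc k)⟯ (RatFunc k) := by
  have hu : (X ^ q - X : k[X]).natDegree = q := FiniteField.X_pow_card_sub_X_natDegree_eq k hq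
  have hu0 : (X ^ q - X : k[X]) ≠ 0 := FiniteField.X_pow_card_sub_X_ne_zero k hq
  set N : k[X] := ((X ^ q - X) ^ (q - 1) + 1) ^ (q + 1) with hN
  set D : k[X] := (X ^ q - X) ^ (q * (q - 1)) with hD
  have hpos : 0 < (q - 1) * q := Nat.mul_pos (by lia) (by lia)
  have hNdeg : N.natDegree = q * (q - 1) * (q + 1) := by
    rw [hN, natDegree_pow, ← C_1, natDegree_add_C, natDegree_pow, hu]
    ring
  have hDdeg : D.natDegree = q * (q - 1) * q := by rw [hD, natDegree_pow, hu]
  have hD0 : D ≠ 0 := pow_ne_zero _ hu0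
  have hN0 : N ≠ 0 := by
    rintro h
    rw [h, natDegree_zero] at hNdeg
    nlinarith
  have hz : pglInvariant q (RatFunc.X : RatFunc k) =
      algebraMap k[X] (RatFunc k) N / algebraMap k[X] (RatFunc k) D := by
    simp [pglInvariant, hN, hD]
  rw [RatFunc.finrank_eq_max_natDegree, hz]
  constructor
  · refine max_le ?_ ?_
    · exact hNdeg ▸ natDegree_le_of_dvd (RatFunc.num_div_dvd N hD0) hN0
    · refine (natDegree_le_of_dvd (RatFunc.denom_div_dvd N D) hD0).trans ?_
      rw [hDdeg]
      exact Nat.mul_le_mul_left _ (Nat.le_succ q)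
  · refine Nat.pos_of_ne_zero fun h => ?_
    rw [Nat.max_eq_zero_iff, ← RatFunc.eq_C_iff] at h
    obtain ⟨c, hc⟩ := h
    rw [div_eq_iff (RatFunc.algebraMap_ne_zero hD0), ← RatFunc.algebraMap_C, ← map_mul] at hc
    have hle : N.natDegree ≤ D.natDegree :=
      RatFunc.algebraMap_injective k hc ▸ natDegree_C_mul_le c D
    rw [hNdeg, hDdeg] at hle
    nlinarith

theorem card_le_finrank_fixedField {F E : Type*} [Field F] [Field E] [Algebra F E]
    (H : Subgroup Gal(E/F)) [FiniteDimensional (fixedField H) E] :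
    Finite H ∧ Nat.card H ≤ Module.finrank (fixedField H) E := by
  have hle : H ≤ fixingSubgroup (fixedField H) := (le_iff_le _ _).mp le_rfl
  have hinj : Function.Injective
      (fixingSubgroupEquiv (fixedField H) ∘ Subgroup.inclusion hle) :=
    (fixingSubgroupEquiv _).injective.comp (Subgroup.inclusion_injective hle)
  refine ⟨Finite.of_injective _ hinj, (Nat.card_le_card_of_injective _ hinj).trans ?_⟩
  rw [Nat.card_eq_fintype_card]
  exact AlgEquiv.card_le

/-- **`PGL(2,q)` case of the classification of finite groups acting on `k(x)`.** Let `p` be a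
prime, `q = p^f`, and `k` an algebraically closed field of characteristic `p` (so that `k`
contains the finite field `F_q`, realized as the elements `a` of `k` with `a^q = a`).  Let `G`
be the group of `k`-algebra automorphisms of `k(x)` of the form `x ↦ (a x + b)/(c x + d)` with
`(a b; c d)` an invertible matrix with entries in `F_q`; `G ≅ PGL(2,q)`.  Then the fixed field
of `G` is `k(z)` with `z = ((x^q - x)^(q-1) + 1)^(q+1) / (x^q - x)^(q(q-1))`. -/
theorem fixedField_PGL_two
    (k : Type*) [Field k] [IsAlgClosed k] (p : ℕ) [Fact p.Prime] [CharP k p]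
    (f q : ℕ) (hf : 1 ≤ f) (hq : q = p ^ f)
    (G : Subgroup (RatFunc k ≃ₐ[k] RatFunc k))
    (hG : ∀ φ : RatFunc k ≃ₐ[k] RatFunc k, φ ∈ G ↔
      ∃ a b c d : k, a ^ q = a ∧ b ^ q = b ∧ c ^ q = c ∧ d ^ q = d ∧
        a * d - b * c ≠ 0 ∧
        φ RatFunc.X = (RatFunc.C a * RatFunc.X + RatFunc.C b) /
          (RatFunc.C c * RatFunc.X + RatFunc.C d)) :
    IntermediateField.fixedField G =
      IntermediateField.adjoin k
        {(((RatFunc.X : RatFunc k) ^ q - RatFunc.X) ^ (q - 1) + 1) ^ (q + 1) /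
          ((RatFunc.X : RatFunc k) ^ q - RatFunc.X) ^ (q * (q - 1))} := by
  have hq1 : 1 < q := hq ▸ Nat.one_lt_pow (by lia) (Fact.out : p.Prime).one_lt
  change fixedField G = k⟮pglInvariant q (RatFunc.X : RatFunc k)⟯
  have : CharP (RatFunc k) p := charP_of_injective_algebraMap (algebraMap k (RatFunc k)).injective p
  have hX : (RatFunc.X : RatFunc k) ^ q - RatFunc.X ≠ 0 := by
    have h := RatFunc.algebraMap_ne_zero (FiniteField.X_pow_card_sub_X_ne_zero k hq1)
    simpa using h
  have hle : k⟮pglInvariant q (RatFunc.X : RatFunc k)⟯ ≤ fixedField G := by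
    rw [adjoin_simple_le_iff, mem_fixedField_iff]
    intro φ hφ
    obtain ⟨a, b, c, d, ha, hb, hc, hd, hdet, hφX⟩ := (hG φ).mp hφ
    have hmap : φ (pglInvariant q RatFunc.X) = pglInvariant q (φ RatFunc.X) := by
      simp [pglInvariant]
    rw [hmap, hφX]
    refine pglInvariant_mobius hq ?_ ?_ ?_ ?_ ?_ (RatFunc.C_mul_X_add_C_ne_zero ?_) hX
    · rw [← map_pow, ha]
    · rw [← map_pow, hb]
    · rw [← map_pow, hc]
    · rw [← map_pow, hd]
    · simpa only [← map_mul, ← map_sub, ne_eq, map_eq_zero] using hdet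
    · by_contra! h0
      simp [h0.1, h0.2] at hdet
  obtain ⟨hdeg, hpos⟩ := finrank_adjoin_pglInvariant_X k hq1
  have := Module.finite_of_finrank_pos hpos
  let := (inclusion hle).toAlgebra
  have : IsScalarTower k⟮pglInvariant q (RatFunc.X : RatFunc k)⟯ (fixedField G) (RatFunc k) :=
    .of_algebraMap_eq' rfl
  have : FiniteDimensional (fixedField G) (RatFunc k) :=
    .right k⟮pglInvariant q (RatFunc.X : RatFunc k)⟯ _ _
  obtain ⟨_, hcard⟩ := card_le_finrank_fixedField G
  refine (eq_of_le_of_finrank_le' hle (hdeg.trans (le_trans ?_ hcard))).symm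
  rw [← card_mobius_parameters k p hf hq]
  have hadd {y z : k} (hy : y ^ q = y) (hz : z ^ q = z) : (y + z) ^ q = y + z := by
    have h : (y + z) ^ q = y ^ q + z ^ q := by
      subst hq
      exact add_pow_char_pow y z p f
    rw [h, hy, hz]
  have hex (s : Option {a : k // a ^ q = a} × {e : {a : k // a ^ q = a} // e.1 ≠ 0} ×
      {a : k // a ^ q = a}) : ∃ φ : G, φ.1 RatFunc.X =
        RatFunc.mobiusNormalForm (s.1.map Subtype.val, s.2.1.1.1, s.2.2.1) := by
    have h0 : (0 : k) ^ q = 0 := zero_pow (by lia)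
    obtain ⟨_ | ⟨a, ha⟩, ⟨⟨e, he⟩, he0⟩, ⟨d, hd⟩⟩ := s
    · have hdet : e * 1 - d * 0 ≠ 0 := by simpa using he0
      obtain ⟨φ, hφ⟩ := RatFunc.exists_algEquiv_mobius hdet
      exact ⟨⟨φ, (hG φ).mpr ⟨e, d, 0, 1, he, hd, h0, one_pow q, hdet, hφ⟩⟩,
        by simp [hφ, RatFunc.mobiusNormalForm]⟩
    · have hdet : a * d - (a * d + e) * 1 ≠ 0 := by simpa using he0
      obtain ⟨φ, hφ⟩ := RatFunc.exists_algEquiv_mobius hdet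
      exact ⟨⟨φ, (hG φ).mpr ⟨a, a * d + e, 1, d, ha,
        hadd (by rw [mul_pow, ha, hd]) he, one_pow q, hd, hdet, hφ⟩⟩, hφ⟩
  choose φ hφ using hex
  refine Nat.card_le_card_of_injective φ fun s t hst => ?_
  have h := RatFunc.mobiusNormalForm_injOn s.2.1.2 t.2.1.2
    ((hφ s).symm.trans (hst ▸ hφ t))
  simp only [Prod.mk.injEq] at h
  exact Prod.ext (Option.map_injective Subtype.val_injective h.1)
    (Prod.ext (Subtype.ext (Subtype.ext h.2.1)) (Subtype.ext h.2.2))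
end

section
/- Let p be an odd prime, q = p^f, and let k be an algebraically closed field of characteristic p containing the finite field F_q. Let G be the group of k-algebra automorphisms of the rational function field k(x) of the form x ↦ (ax + b)/(cx + d) with (a b; c d) ∈ SL(2, F_q); G is isomorphic to PSL(2, q). Then the fixed field of G is k(z), where z = ((x^q − x)^{q−1} + 1)^{(q+1)/2} / (x^q − x)^{q(q−1)/2}. -/
open Polynomial in
/-- Coefficientwise comparison of linear polynomials inside `k(x)`. -/
theorem RatFunc.linear_injective {k : Type*} [Field k] {a b a' b' : k}
    (h : RatFunc.C a * RatFunc.X + RatFunc.C b = RatFunc.C a' * RatFunc.X + RatFunc.C b') :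
    a = a' ∧ b = b' := by
  have h1 : algebraMap k[X] (RatFunc k) (Polynomial.C a * Polynomial.X + Polynomial.C b) =
      algebraMap k[X] (RatFunc k) (Polynomial.C a' * Polynomial.X + Polynomial.C b') := by
    simpa [RatFunc.algebraMap_C, RatFunc.algebraMap_X] using h
  have h2 := RatFunc.algebraMap_injective k h1
  constructor
  · simpa using congrArg (fun P => coeff P 1) h2
  · simpa using congrArg (fun P => coeff P 0) h2

open Polynomial in
/-- Coefficientwise comparison of quadratic polynomials inside `k(x)`. -/
theorem RatFunc.quadratic_injective {k : Type*} [Field k] {a b c a' b' c' : k}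
    (h : RatFunc.C a * RatFunc.X ^ 2 + RatFunc.C b * RatFunc.X + RatFunc.C c =
      RatFunc.C a' * RatFunc.X ^ 2 + RatFunc.C b' * RatFunc.X + RatFunc.C c') :
    a = a' ∧ b = b' ∧ c = c' := by
  have h1 : algebraMap k[X] (RatFunc k)
        (Polynomial.C a * Polynomial.X ^ 2 + Polynomial.C b * Polynomial.X + Polynomial.C c) =
      algebraMap k[X] (RatFunc k)
        (Polynomial.C a' * Polynomial.X ^ 2 + Polynomial.C b' * Polynomial.X + Polynomial.C c') := by
    simpa [RatFunc.algebraMap_C, RatFunc.algebraMap_X] using h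
  have h2 := RatFunc.algebraMap_injective k h1
  refine ⟨?_, ?_, ?_⟩
  · simpa [Polynomial.coeff_X, Polynomial.coeff_C] using congrArg (fun P => coeff P 2) h2
  · simpa [Polynomial.coeff_X, Polynomial.coeff_C] using congrArg (fun P => coeff P 1) h2
  · simpa [Polynomial.coeff_X, Polynomial.coeff_C] using congrArg (fun P => coeff P 0) h2

theorem RatFunc.linear_ne_zero {k : Type*} [Field k] {a b c d : k} (h : a * d - b * c = 1) :
    RatFunc.C c * RatFunc.X + RatFunc.C d ≠ 0 := by
  intro h0
  have := RatFunc.linear_injective (a := c) (b := d) (a' := 0) (b' := 0) (by simpa using h0)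
  obtain ⟨rfl, rfl⟩ := this
  simp at h

/-- The rational function `(a x + b) / (c x + d)`. -/
noncomputable def RatFunc.moebius {k : Type*} [Field k] (a b c d : k) : RatFunc k :=
  (RatFunc.C a * RatFunc.X + RatFunc.C b) / (RatFunc.C c * RatFunc.X + RatFunc.C d)

theorem RatFunc.moebius_ne_C {k : Type*} [Field k] {a b c d : k} (h : a * d - b * c = 1) :
    ¬ ∃ e, RatFunc.moebius a b c d = RatFunc.C e := by
  rintro ⟨e, he⟩
  rw [RatFunc.moebius, div_eq_iff (RatFunc.linear_ne_zero h)] at he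
  obtain ⟨rfl, rfl⟩ := RatFunc.linear_injective (a := a) (b := b) (a' := e * c) (b' := e * d)
    (by rw [he]; simp only [map_mul]; ring)
  exact zero_ne_one (α := k) (by rw [← h]; ring)

theorem RatFunc.eq_or_eq_neg_of_moebius_eq {k : Type*} [Field k] {a b c d a' b' c' d' : k}
    (h : a * d - b * c = 1) (h' : a' * d' - b' * c' = 1)
    (he : RatFunc.moebius a b c d = RatFunc.moebius a' b' c' d') :
    (a, b, c, d) = (a', b', c', d') ∨ (a, b, c, d) = (-a', -b', -c', -d') := by
  rw [RatFunc.moebius, RatFunc.moebius,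
    div_eq_div_iff (RatFunc.linear_ne_zero h) (RatFunc.linear_ne_zero h')] at he
  obtain ⟨h2, h1, h0⟩ := RatFunc.quadratic_injective (a := a * c') (b := a * d' + b * c')
    (c := b * d') (a' := a' * c) (b' := a' * d + b' * c) (c' := b' * d)
    (by simp only [map_mul, map_add]; linear_combination he)
  have hl : (a * d' - b * c') ^ 2 = 1 := by grind
  have ha : a = (a * d' - b * c') * a' := by grind
  have hb : b = (a * d' - b * c') * b' := by grind
  have hc : c = (a * d' - b * c') * c' := by grind
  have hd : d = (a * d' - b * c') * d' := by grind
  rcases eq_or_eq_neg_of_sq_eq_sq (a * d' - b * c') 1 (by rw [hl, one_pow]) with hl | hl <;>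
    rw [hl] at ha hb hc hd
  · left; simp_all
  · right; simp_all

open Polynomial in
/-- The endomorphism `x ↦ u` of `k(x)` for a nonconstant `u`. -/
theorem RatFunc.exists_algHom_X {k : Type*} [Field k] {u : RatFunc k}
    (hu : ¬ ∃ e, u = RatFunc.C e) :
    ∃ φ : RatFunc k →ₐ[k] RatFunc k, φ RatFunc.X = u := by
  have hinj : Function.Injective (aeval (R := k) u) :=
    transcendental_iff_injective.mp (RatFunc.transcendental_of_ne_C u hu)
  refine ⟨RatFunc.liftAlgHom (aeval u) ?_, ?_⟩
  · exact nonZeroDivisors_le_comap_nonZeroDivisors_of_injective _ hinj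
  · simp [RatFunc.liftAlgHom_apply]

open Polynomial in
theorem RatFunc.algHom_ext_X {k : Type*} [Field k] {φ ψ : RatFunc k →ₐ[k] RatFunc k}
    (h : φ RatFunc.X = ψ RatFunc.X) : φ = ψ := by
  ext y
  induction y using RatFunc.induction_on with
  | f P Q hQ =>
    have key (R : k[X]) : φ (algebraMap k[X] (RatFunc k) R) = ψ (algebraMap k[X] (RatFunc k) R) := by
      have : φ.comp (IsScalarTower.toAlgHom k k[X] (RatFunc k)) =
          ψ.comp (IsScalarTower.toAlgHom k k[X] (RatFunc k)) := by
        apply Polynomial.algHom_ext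
        simpa [RatFunc.algebraMap_X] using h
      exact DFunLike.congr_fun this R
    rw [map_div₀, map_div₀, key, key]

theorem RatFunc.map_moebius {k : Type*} [Field k] (φ : RatFunc k →ₐ[k] RatFunc k) (a b c d : k) :
    φ (RatFunc.moebius a b c d) =
      (RatFunc.C a * φ RatFunc.X + RatFunc.C b) / (RatFunc.C c * φ RatFunc.X + RatFunc.C d) := by
  have h (e : k) : φ (RatFunc.C e) = RatFunc.C e := φ.commutes e
  simp [RatFunc.moebius, h]

theorem moebius_comp_inv {L : Type*} [Field L] {a b c d x : L} (h : a * d - b * c = 1)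
    (hv : c * x + d ≠ 0) :
    (d * ((a * x + b) / (c * x + d)) + -b) / (-c * ((a * x + b) / (c * x + d)) + a) = x := by
  have h1 : -c * ((a * x + b) / (c * x + d)) + a = 1 / (c * x + d) := by
    rw [eq_div_iff hv, add_mul, mul_assoc, div_mul_cancel₀ _ hv]
    linear_combination h
  rw [h1, div_div_eq_mul_div, div_one, add_mul, mul_assoc, div_mul_cancel₀ _ hv]
  linear_combination x * h

/-- Determinant-one fractional linear substitutions are automorphisms of `k(x)`. -/
theorem RatFunc.exists_algEquiv_moebius {k : Type*} [Field k] {a b c d : k}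
    (h : a * d - b * c = 1) :
    ∃ φ : RatFunc k ≃ₐ[k] RatFunc k, φ RatFunc.X = RatFunc.moebius a b c d := by
  have comp_inv {a b c d : k} (h : a * d - b * c = 1) (φ ψ : RatFunc k →ₐ[k] RatFunc k)
      (hφ : φ RatFunc.X = RatFunc.moebius a b c d)
      (hψ : ψ RatFunc.X = RatFunc.moebius d (-b) (-c) a) : φ.comp ψ = AlgHom.id k _ := by
    apply RatFunc.algHom_ext_X
    have hC : RatFunc.C a * RatFunc.C d - RatFunc.C b * RatFunc.C c = 1 := by
      simpa using congrArg RatFunc.C h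
    have hv := RatFunc.linear_ne_zero h
    rw [AlgHom.comp_apply, hψ, RatFunc.map_moebius, hφ, RatFunc.moebius]
    simp only [map_neg, AlgHom.id_apply]
    exact moebius_comp_inv hC hv
  have h' : d * a - (-b) * (-c) = 1 := by rw [← h]; ring
  obtain ⟨φ, hφ⟩ := RatFunc.exists_algHom_X (RatFunc.moebius_ne_C h)
  obtain ⟨ψ, hψ⟩ := RatFunc.exists_algHom_X (RatFunc.moebius_ne_C h')
  exact ⟨AlgEquiv.ofAlgHom φ ψ (comp_inv h φ ψ hφ hψ)
    (comp_inv h' ψ φ hψ (by simpa using hφ)), hφ⟩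

/-- The determinant-one `2 × 2` matrices over `F`, as quadruples of entries. -/
def specialLinearQuadruples {k : Type*} [Field k] [DecidableEq k] (F : Finset k) :
    Finset (k × k × k × k) :=
  {m ∈ F ×ˢ F ×ˢ F ×ˢ F | m.1 * m.2.2.2 - m.2.1 * m.2.2.1 = 1}

theorem le_card_specialLinearQuadruples {k : Type*} [Field k] [DecidableEq k] (F : Finset k)
    (K : Subfield k) (hF : ∀ x, x ∈ F ↔ x ∈ K) :
    F.card * (F.card - 1) * (F.card + 1) ≤ (specialLinearQuadruples F).card := by
  have h0 : (0 : k) ∈ F := (hF 0).2 K.zero_mem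
  let S₁ := (F ×ˢ F.erase 0 ×ˢ F).image
    fun t : k × k × k => (t.1, (t.1 * t.2.2 - 1) / t.2.1, t.2.1, t.2.2)
  let S₂ := (F.erase 0 ×ˢ F).image fun t : k × k => (t.1, t.2, (0 : k), t.1⁻¹)
  have c₁ : S₁.card = F.card * ((F.card - 1) * F.card) := by
    rw [Finset.card_image_of_injective, Finset.card_product, Finset.card_product,
      Finset.card_erase_of_mem h0]
    rintro ⟨a, c, d⟩ ⟨a', c', d'⟩ h
    simp_all
  have c₂ : S₂.card = (F.card - 1) * F.card := by
    rw [Finset.card_image_of_injective, Finset.card_product, Finset.card_erase_of_mem h0]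
    rintro ⟨a, b⟩ ⟨a', b'⟩ h
    simp_all
  have hdisj : Disjoint S₁ S₂ := by
    rw [Finset.disjoint_left]
    intro m h1 h2
    simp only [S₁, S₂, Finset.mem_image, Finset.mem_product, Finset.mem_erase] at h1 h2
    obtain ⟨⟨a, c, d⟩, ⟨-, ⟨hc, -⟩, -⟩, rfl⟩ := h1
    obtain ⟨⟨a', b'⟩, -, h⟩ := h2
    simp only [Prod.mk.injEq] at h
    exact hc h.2.2.1.symm
  have hsub : S₁ ∪ S₂ ⊆ specialLinearQuadruples F := by
    intro m hm
    simp only [S₁, S₂, Finset.mem_union, Finset.mem_image, Finset.mem_product,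
      Finset.mem_erase, hF] at hm
    simp only [specialLinearQuadruples, Finset.mem_filter, Finset.mem_product, hF]
    rcases hm with ⟨⟨a, c, d⟩, ⟨ha, ⟨hc0, hc⟩, hd⟩, rfl⟩ | ⟨⟨a, b⟩, ⟨⟨ha0, ha⟩, hb⟩, rfl⟩
    · exact ⟨⟨ha, K.div_mem (K.sub_mem (K.mul_mem ha hd) K.one_mem) hc, hc, hd⟩, by
        simp only at hc0 ⊢; field_simp; ring⟩
    · exact ⟨⟨ha, hb, K.zero_mem, K.inv_mem ha⟩, by simp only at ha0 ⊢; field_simp; ring⟩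
  have := Finset.card_le_card hsub
  rw [Finset.card_union_of_disjoint hdisj, c₁, c₂] at this
  calc _ = _ := by ring
    _ ≤ _ := this

theorem card_specialLinearQuadruples_le {k : Type*} [Field k] [DecidableEq k] (F : Finset k) :
    ∃ T : Finset (RatFunc k), (specialLinearQuadruples F).card ≤ 2 * T.card ∧
      ∀ u ∈ T, ∃ a ∈ F, ∃ b ∈ F, ∃ c ∈ F, ∃ d ∈ F, a * d - b * c = 1 ∧
        u = RatFunc.moebius a b c d := by
  classical
  refine ⟨(specialLinearQuadruples F).image fun m => RatFunc.moebius m.1 m.2.1 m.2.2.1 m.2.2.2,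
    Finset.card_le_mul_card_image _ _ ?_, ?_⟩
  · intro u hu
    obtain ⟨⟨a, b, c, d⟩, hm, rfl⟩ := Finset.mem_image.1 hu
    refine (Finset.card_le_card (t := {(a, b, c, d), (-a, -b, -c, -d)}) ?_).trans
      Finset.card_le_two
    rintro ⟨a', b', c', d'⟩ hm'
    simp only [specialLinearQuadruples, Finset.mem_filter] at hm hm'
    rcases RatFunc.eq_or_eq_neg_of_moebius_eq hm'.1.2 hm.2 hm'.2 with h | h <;> simp [h]
  · intro u hu
    obtain ⟨⟨a, b, c, d⟩, hm, rfl⟩ := Finset.mem_image.1 hu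
    simp only [specialLinearQuadruples, Finset.mem_filter, Finset.mem_product] at hm
    exact ⟨a, hm.1.1, b, hm.1.2.1, c, hm.1.2.2.1, d, hm.1.2.2.2, hm.2, rfl⟩

/-- Conjugates of a single element bound the degree over a fixed field from below. -/
theorem card_le_finrank_fixedField_s15 {k L : Type*} [Field k] [Field L] [Algebra k L]
    (G : Subgroup (L ≃ₐ[k] L)) [FiniteDimensional (IntermediateField.fixedField G) L]
    (x : L) (T : Finset L) (hT : ∀ u ∈ T, ∃ φ ∈ G, φ x = u) :
    T.card ≤ Module.finrank (IntermediateField.fixedField G) L := by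
  classical
  have hint : IsIntegral (IntermediateField.fixedField G) x := Algebra.IsIntegral.isIntegral x
  set P := minpoly (IntermediateField.fixedField G) x with hP
  have hsub : T ⊆ (P.map (algebraMap (IntermediateField.fixedField G) L)).roots.toFinset := by
    intro u hu
    obtain ⟨φ, hφ, rfl⟩ := hT u hu
    rw [Multiset.mem_toFinset, Polynomial.mem_roots
      (Polynomial.map_ne_zero (minpoly.ne_zero hint)), Polynomial.IsRoot, Polynomial.eval_map]
    have hcomp : (φ : L →+* L).comp (algebraMap (IntermediateField.fixedField G) L) =
        algebraMap (IntermediateField.fixedField G) L := by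
      ext y
      exact y.2 ⟨φ, hφ⟩
    have h := Polynomial.hom_eval₂ P (algebraMap (IntermediateField.fixedField G) L)
      (φ : L →+* L) x
    rw [hcomp, ← Polynomial.aeval_def, hP, minpoly.aeval] at h
    simpa using h.symm
  calc T.card ≤ _ := Finset.card_le_card hsub
    _ ≤ _ := Multiset.toFinset_card_le _
    _ ≤ _ := Polynomial.card_roots' _
    _ = P.natDegree := Polynomial.natDegree_map _
    _ ≤ _ := minpoly.natDegree_le x

/-- The rational function generating the `PSL(2,q)`-invariants takes the same value at
`(a x + b) / (c x + d)` and at `x`; here `m = (q - 1) / 2`. -/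
theorem moebius_invariant {k : Type*} [Field k] (p : ℕ) [Fact p.Prime] [CharP k p]
    (f q m : ℕ) (hq : q = p ^ f) (hm : q = 2 * m + 1) (hm0 : m ≠ 0) {a b c d : k}
    (ha : a ^ q = a) (hb : b ^ q = b) (hc : c ^ q = c) (hd : d ^ q = d)
    (h : a * d - b * c = 1) :
    ((RatFunc.moebius a b c d ^ q - RatFunc.moebius a b c d) ^ (q - 1) + 1) ^ (m + 1) /
        (RatFunc.moebius a b c d ^ q - RatFunc.moebius a b c d) ^ (q * m) =
      (((RatFunc.X : RatFunc k) ^ q - RatFunc.X) ^ (q - 1) + 1) ^ (m + 1) /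
        ((RatFunc.X : RatFunc k) ^ q - RatFunc.X) ^ (q * m) := by
  have : CharP (RatFunc k) p := charP_of_injective_algebraMap (algebraMap k (RatFunc k)).injective p
  have lin_pow (a b : k) (ha : a ^ q = a) (hb : b ^ q = b) (y : RatFunc k) :
      (RatFunc.C a * y + RatFunc.C b) ^ q = RatFunc.C a * y ^ q + RatFunc.C b := by
    conv_lhs => rw [hq, add_pow_char_pow, ← hq, mul_pow, ← map_pow, ← map_pow, ha, hb]
  have hC : RatFunc.C a * RatFunc.C d - RatFunc.C b * RatFunc.C c = 1 := by
    simpa using congrArg RatFunc.C h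
  set x : RatFunc k := RatFunc.X with hx
  have hv := RatFunc.linear_ne_zero h
  have hvq := lin_pow c d hc hd x
  have huq := lin_pow a b ha hb x
  have hvqq := lin_pow c d hc hd (x ^ q)
  have huqq := lin_pow a b ha hb (x ^ q)
  rw [← hvq] at hvqq
  rw [← huq] at huqq
  set v : RatFunc k := RatFunc.C c * x + RatFunc.C d with hvdef
  set w : RatFunc k := RatFunc.C a * x + RatFunc.C b with hwdef
  have hu : RatFunc.moebius a b c d = w / v := rfl
  have hq1 : (q - 1) + 1 = q := by omega
  have key (y : RatFunc k) : (y ^ q - y) * ((y ^ q - y) ^ (q - 1) + 1) = (y ^ q) ^ q - y := by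
    have : (y ^ q - y) ^ q = (y ^ q) ^ q - y ^ q := by
      conv_lhs => rw [hq, sub_pow_char_pow, ← hq]
    rw [mul_add, ← pow_succ', hq1, this]
    ring
  have hL : x ^ q - x ≠ 0 := by
    have h0 := RatFunc.algebraMap_ne_zero
      (FiniteField.X_pow_card_sub_X_ne_zero k (p := q) (by omega))
    simpa [RatFunc.algebraMap_X] using h0
  have hLu : (w / v) ^ q - w / v = (x ^ q - x) / v ^ (q + 1) := by
    rw [div_pow, pow_succ, div_sub_div _ _ (pow_ne_zero _ hv) hv, huq, hvq, hvdef, hwdef]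
    congr 1
    linear_combination (x ^ q - x) * hC
  have hBu : ((w / v) ^ q) ^ q - w / v = ((x ^ q) ^ q - x) / ((v ^ q) ^ q * v) := by
    rw [div_pow, div_pow, div_sub_div _ _ (pow_ne_zero _ (pow_ne_zero _ hv)) hv, huqq, hvqq,
      hvdef, hwdef]
    congr 1
    linear_combination ((x ^ q) ^ q - x) * hC
  have hAu : ((w / v) ^ q - w / v) ^ (q - 1) + 1 =
      ((x ^ q - x) ^ (q - 1) + 1) / v ^ (q * (q - 1)) := by
    have hne : (w / v) ^ q - w / v ≠ 0 := by
      rw [hLu]; exact div_ne_zero hL (pow_ne_zero _ hv)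
    apply mul_left_cancel₀ hne
    rw [key, hBu, ← key x, hLu, div_mul_div_comm, ← pow_add]
    congr 1
    rw [← pow_mul, ← pow_succ]
    congr 1
    subst hm
    simp only [Nat.add_sub_cancel]
    ring
  rw [hu, hAu, hLu, div_pow, div_pow, ← pow_mul, ← pow_mul]
  have hexp : q * (q - 1) * (m + 1) = (q + 1) * (q * m) := by
    subst hm
    simp only [Nat.add_sub_cancel]
    ring
  rw [hexp, div_div_div_cancel_right₀ (pow_ne_zero _ hv)]

open Polynomial in
/-- A quotient of polynomials of degrees `N > M` generates a subfield of index at most `N`. -/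
theorem RatFunc.finrank_adjoin_div {k : Type*} [Field k] {P Q : k[X]} (hQ : Q ≠ 0)
    (h : Q.natDegree < P.natDegree) :
    0 < Module.finrank (IntermediateField.adjoin k
        {algebraMap k[X] (RatFunc k) P / algebraMap k[X] (RatFunc k) Q}) (RatFunc k) ∧
      Module.finrank (IntermediateField.adjoin k
        {algebraMap k[X] (RatFunc k) P / algebraMap k[X] (RatFunc k) Q}) (RatFunc k) ≤
        P.natDegree := by
  have hP : P ≠ 0 := by rintro rfl; simp at h
  rw [RatFunc.finrank_eq_max_natDegree]
  constructor
  · have hdeg : RatFunc.intDegree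
        (algebraMap k[X] (RatFunc k) P / algebraMap k[X] (RatFunc k) Q) =
          P.natDegree - Q.natDegree := by
      rw [RatFunc.intDegree_div (RatFunc.algebraMap_ne_zero hP) (RatFunc.algebraMap_ne_zero hQ),
        RatFunc.intDegree_polynomial, RatFunc.intDegree_polynomial]
    rw [RatFunc.intDegree] at hdeg
    omega
  · exact max_le (natDegree_le_of_dvd (RatFunc.num_div_dvd P hQ) hP)
      ((natDegree_le_of_dvd (RatFunc.denom_div_dvd P Q) hQ).trans h.le)


/-- **`PSL(2,q)` case of the classification of finite groups acting on `k(x)`.** Let `p` be an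
odd prime, `q = p^f`, and `k` an algebraically closed field of characteristic `p` (so that `k`
contains the finite field `F_q`, realized as the elements `a` of `k` with `a^q = a`).  Let `G`
be the group of `k`-algebra automorphisms of `k(x)` of the form `x ↦ (a x + b)/(c x + d)` with
`(a b; c d)` a determinant-one matrix with entries in `F_q`; `G ≅ PSL(2,q)`.  Then the fixed
field of `G` is `k(z)` with `z = ((x^q - x)^(q-1) + 1)^((q+1)/2) / (x^q - x)^(q(q-1)/2)`. -/
theorem fixedField_PSL_two
    (k : Type*) [Field k] [IsAlgClosed k] (p : ℕ) [Fact p.Prime] (hp : Odd p) [CharP k p]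
    (f q : ℕ) (hf : 1 ≤ f) (hq : q = p ^ f)
    (G : Subgroup (RatFunc k ≃ₐ[k] RatFunc k))
    (hG : ∀ φ : RatFunc k ≃ₐ[k] RatFunc k, φ ∈ G ↔
      ∃ a b c d : k, a ^ q = a ∧ b ^ q = b ∧ c ^ q = c ∧ d ^ q = d ∧
        a * d - b * c = 1 ∧
        φ RatFunc.X = (RatFunc.C a * RatFunc.X + RatFunc.C b) /
          (RatFunc.C c * RatFunc.X + RatFunc.C d)) :
    IntermediateField.fixedField G =
      IntermediateField.adjoin k
        {(((RatFunc.X : RatFunc k) ^ q - RatFunc.X) ^ (q - 1) + 1) ^ ((q + 1) / 2) /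
          ((RatFunc.X : RatFunc k) ^ q - RatFunc.X) ^ (q * (q - 1) / 2)} := by
  classical
  have hp1 : 1 < p := (Fact.out : p.Prime).one_lt
  have hqodd : Odd q := hq ▸ hp.pow
  have hq1 : 1 < q := hq ▸ Nat.one_lt_pow (by omega) hp1
  obtain ⟨m, hm⟩ := hqodd
  have hm0 : m ≠ 0 := by omega
  have e₁ : (q + 1) / 2 = m + 1 := by omega
  have e₂ : q * (q - 1) / 2 = q * m := by
    rw [hm, Nat.add_sub_cancel, mul_left_comm, Nat.mul_div_cancel_left _ two_pos]
  rw [e₁, e₂]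
  set z : RatFunc k := (((RatFunc.X : RatFunc k) ^ q - RatFunc.X) ^ (q - 1) + 1) ^ (m + 1) /
    ((RatFunc.X : RatFunc k) ^ q - RatFunc.X) ^ (q * m) with hz
  have hle : IntermediateField.adjoin k {z} ≤ IntermediateField.fixedField G := by
    rw [IntermediateField.adjoin_simple_le_iff, IntermediateField.mem_fixedField_iff]
    intro φ hφ
    obtain ⟨a, b, c, d, ha, hb, hc, hd, hdet, hφX⟩ := (hG φ).1 hφ
    have := moebius_invariant p f q m hq hm hm0 ha hb hc hd hdet
    rw [RatFunc.moebius, ← hφX, ← hz] at this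
    simpa [hz] using this
  have hL : (Polynomial.X ^ q - Polynomial.X : Polynomial k).natDegree = q :=
    FiniteField.X_pow_card_sub_X_natDegree_eq k hq1
  have hL0 : (Polynomial.X ^ q - Polynomial.X : Polynomial k) ≠ 0 :=
    FiniteField.X_pow_card_sub_X_ne_zero k hq1
  have hnum : (((Polynomial.X ^ q - Polynomial.X : Polynomial k) ^ (q - 1) + 1) ^
      (m + 1)).natDegree = q * (q - 1) * (m + 1) := by
    rw [Polynomial.natDegree_pow, ← Polynomial.C_1, Polynomial.natDegree_add_C,
      Polynomial.natDegree_pow, hL]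
    ring
  have hden : ((Polynomial.X ^ q - Polynomial.X : Polynomial k) ^ (q * m)).natDegree =
      q * m * q := by
    rw [Polynomial.natDegree_pow, hL]
  obtain ⟨hpos, hupper⟩ := RatFunc.finrank_adjoin_div (pow_ne_zero (q * m) hL0)
    (P := ((Polynomial.X ^ q - Polynomial.X : Polynomial k) ^ (q - 1) + 1) ^ (m + 1)) (by
      rw [hnum, hden, hm, Nat.add_sub_cancel]
      have : 0 < m := by omega
      nlinarith [mul_pos this this])
  have hzpoly : z = algebraMap (Polynomial k) (RatFunc k)
        (((Polynomial.X ^ q - Polynomial.X) ^ (q - 1) + 1) ^ (m + 1)) /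
      algebraMap (Polynomial k) (RatFunc k) ((Polynomial.X ^ q - Polynomial.X) ^ (q * m)) := by
    simp [hz, RatFunc.algebraMap_X]
  rw [← hzpoly] at hpos hupper
  rw [hnum] at hupper
  have : FiniteDimensional (IntermediateField.adjoin k {z}) (RatFunc k) :=
    Module.finite_of_finrank_pos hpos
  have : FiniteDimensional (IntermediateField.fixedField G) (RatFunc k) := by
    let := (IntermediateField.inclusion hle).toRingHom.toAlgebra
    have : IsScalarTower (IntermediateField.adjoin k {z}) (IntermediateField.fixedField G)
      (RatFunc k) := IsScalarTower.of_algebraMap_eq fun _ => rfl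
    exact FiniteDimensional.right (IntermediateField.adjoin k {z}) _ _
  refine (IntermediateField.eq_of_le_of_finrank_le' hle ?_).symm
  let F : Finset k := (Polynomial.X ^ q - Polynomial.X : Polynomial k).roots.toFinset
  have hF (a : k) : a ∈ F ↔ a ^ q = a := by
    simp [F, hL0, sub_eq_zero]
  have hFcard : F.card = q := by
    have hsep : (Polynomial.X ^ q - Polynomial.X : Polynomial k).Separable :=
      galois_poly_separable p q (hq ▸ dvd_pow_self p (by omega))
    rw [Multiset.toFinset_card_of_nodup (Polynomial.nodup_roots hsep),
      ← (IsAlgClosed.splits _).natDegree_eq_card_roots, hL]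
  let K : Subfield k := (iterateFrobenius k p f).eqLocusField (RingHom.id k)
  have hK (a : k) : a ∈ F ↔ a ∈ K := by
    rw [hF, hq]
    exact Iff.rfl
  obtain ⟨T, hcard, hT⟩ := card_specialLinearQuadruples_le F
  have hlower := card_le_finrank_fixedField_s15 G RatFunc.X T (by
    intro u hu
    obtain ⟨a, ha, b, hb, c, hc, d, hd, hdet, rfl⟩ := hT u hu
    rw [hF] at ha hb hc hd
    obtain ⟨φ, hφ⟩ := RatFunc.exists_algEquiv_moebius hdet
    exact ⟨φ, (hG φ).2 ⟨a, b, c, d, ha, hb, hc, hd, hdet, hφ⟩, hφ⟩)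
  have hS := le_card_specialLinearQuadruples F K hK
  rw [hFcard] at hS
  have h2 : q * (q - 1) * (q + 1) = 2 * (q * (q - 1) * (m + 1)) := by
    rw [show q + 1 = 2 * (m + 1) by omega]
    ring
  omega
end

section
/- Let k be an algebraically closed field of characteristic 2 and let R ∈ k(x) be a rational function. Then there exists Q ∈ k(x) such that the rational function R + Q + Q^2 has no poles of even order; that is, for every a ∈ k the order of vanishing of R + Q + Q^2 at x = a is not a negative even integer, and its order at infinity (the degree of its denominator minus the degree of its numerator) is not a negative even integer. -/
namespace RatFunc

open Polynomial

variable {k : Type*} [Field k]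

/-- The height of a rational function, that is, its degree as a self-map of the projective line. -/
noncomputable def height (R : RatFunc k) : ℕ :=
  max R.num.natDegree R.denom.natDegree

theorem height_div_lt {p q : k[X]} {n : ℕ} (hq : q ≠ 0) (hpn : p.natDegree < n)
    (hqn : q.natDegree < n) :
    (algebraMap k[X] (RatFunc k) p / algebraMap k[X] (RatFunc k) q).height < n := by
  refine max_lt (lt_of_le_of_lt ?_ hpn) (lt_of_le_of_lt ?_ hqn)
  · rcases eq_or_ne p 0 with rfl | hp
    · simp
    · exact natDegree_le_of_dvd (num_div_dvd p hq) hp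
  · exact natDegree_le_of_dvd (denom_div_dvd p q) hq

variable [IsAlgClosed k] [CharP k 2]

/-- An even order pole at a finite place can be removed at the cost of lowering the height. -/
theorem exists_height_lt_of_even_pole {R : RatFunc k} {a : k} {m : ℕ} (hm : m ≠ 0)
    (h : R.denom.rootMultiplicity a = 2 * m) :
    ∃ Q : RatFunc k, (R + Q + Q ^ 2).height < R.height := by
  have hd : R.denom ≠ 0 := R.denom_ne_zero
  obtain ⟨q, hq, hqa⟩ := exists_eq_pow_rootMultiplicity_mul_and_not_dvd R.denom hd a
  rw [h] at hq
  rw [dvd_iff_isRoot, IsRoot.def] at hqa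
  have hq0 : q ≠ 0 := by rintro rfl; simp at hqa
  obtain ⟨s, hs⟩ := IsAlgClosed.exists_pow_nat_eq (R.num.eval a / q.eval a) (n := 2) (by norm_num)
  set t : k[X] := Polynomial.X - Polynomial.C a with ht
  have htm : t.Monic := monic_X_sub_C a
  have htd : t.natDegree = 1 := natDegree_X_sub_C a
  obtain ⟨p, hp⟩ : t ∣ R.num + Polynomial.C s * t ^ m * q + Polynomial.C (s ^ 2) * q := by
    rw [ht, dvd_iff_isRoot, IsRoot.def]
    simp only [Polynomial.eval_add, Polynomial.eval_mul, Polynomial.eval_C, Polynomial.eval_pow,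
      Polynomial.eval_sub, Polynomial.eval_X, sub_self, zero_pow hm, hs,
      div_mul_cancel₀ _ hqa, mul_zero, zero_mul, add_zero, CharTwo.add_self_eq_zero]
  have hdeg : R.denom.natDegree = 2 * m + q.natDegree := by
    rw [hq, (htm.pow _).natDegree_mul' hq0, htm.natDegree_pow, htd, mul_one]
  have htq : t ^ (2 * m - 1) * q ≠ 0 := mul_ne_zero (htm.pow (2 * m - 1)).ne_zero hq0
  have hdh : R.denom.natDegree ≤ R.height := le_max_right _ _
  have hnh : R.num.natDegree ≤ R.height := le_max_left _ _
  have key : R + algebraMap k[X] (RatFunc k) (Polynomial.C s) / algebraMap k[X] (RatFunc k) (t ^ m)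
      + (algebraMap k[X] (RatFunc k) (Polynomial.C s) / algebraMap k[X] (RatFunc k) (t ^ m)) ^ 2
      = algebraMap k[X] (RatFunc k) p / algebraMap k[X] (RatFunc k) (t ^ (2 * m - 1) * q) := by
    have ht0 : algebraMap k[X] (RatFunc k) t ≠ 0 := algebraMap_ne_zero htm.ne_zero
    have hq0' : algebraMap k[X] (RatFunc k) q ≠ 0 := algebraMap_ne_zero hq0
    have hp' := congrArg (algebraMap k[X] (RatFunc k)) hp
    have hR := R.num_div_denom
    rw [hq] at hR
    obtain ⟨j, rfl⟩ : ∃ j, m = j + 1 := ⟨m - 1, by omega⟩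
    rw [show 2 * (j + 1) - 1 = 2 * j + 1 by omega]
    simp only [map_add, map_mul, map_pow] at hp' hR ⊢
    rw [← hR, ← mul_div_mul_left (algebraMap k[X] (RatFunc k) p) _ ht0, ← hp']
    field_simp
    ring
  refine ⟨_, key ▸ height_div_lt htq ?_ ?_⟩
  · rcases eq_or_ne p 0 with rfl | hp0
    · simp only [natDegree_zero]; omega
    · have h1 : (t * p).natDegree = 1 + p.natDegree := by
        rw [htm.natDegree_mul' hp0, htd]
      have h2 : (R.num + Polynomial.C s * t ^ m * q + Polynomial.C (s ^ 2) * q).natDegree ≤ R.height := by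
        refine natDegree_add_le_of_degree_le (natDegree_add_le_of_degree_le hnh ?_) ?_
        · refine natDegree_mul_le.trans ((add_le_add_left (natDegree_C_mul_le _ _) _).trans ?_)
          rw [htm.natDegree_pow, htd]; omega
        · exact (natDegree_C_mul_le _ _).trans (by omega)
      rw [hp] at h2
      omega
  · rw [(htm.pow _).natDegree_mul' hq0, htm.natDegree_pow, htd]
    omega

/-- An even order pole at infinity can be removed at the cost of lowering the height. -/
theorem exists_height_lt_of_even_pole_infty {R : RatFunc k} {m : ℕ} (hm : m ≠ 0)
    (h : R.num.natDegree = R.denom.natDegree + 2 * m) :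
    ∃ Q : RatFunc k, (R + Q + Q ^ 2).height < R.height := by
  have hd : R.denom ≠ 0 := R.denom_ne_zero
  obtain ⟨s, hs⟩ := IsAlgClosed.exists_pow_nat_eq R.num.leadingCoeff (n := 2) (by norm_num)
  have hh : R.height = R.num.natDegree := max_eq_left (by omega)
  have key : R + algebraMap k[X] (RatFunc k) (Polynomial.C s * Polynomial.X ^ m)
      + (algebraMap k[X] (RatFunc k) (Polynomial.C s * Polynomial.X ^ m)) ^ 2
      = algebraMap k[X] (RatFunc k)
          (R.num + Polynomial.C s * Polynomial.X ^ m * R.denom + Polynomial.C (s ^ 2) * Polynomial.X ^ (2 * m) * R.denom) /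
        algebraMap k[X] (RatFunc k) R.denom := by
    have hd' : algebraMap k[X] (RatFunc k) R.denom ≠ 0 := algebraMap_ne_zero hd
    rw [eq_div_iff hd', add_mul, add_mul]
    conv_lhs => enter [1, 1, 1]; rw [← R.num_div_denom]
    rw [div_mul_cancel₀ _ hd']
    simp only [map_add, map_mul, map_pow]
    ring
  refine ⟨_, key ▸ height_div_lt hd ?_ (by omega)⟩
  rw [hh]
  have h1 : (Polynomial.C s * Polynomial.X ^ m * R.denom).natDegree < R.num.natDegree := by
    refine (natDegree_mul_le.trans (add_le_add_left (natDegree_C_mul_X_pow_le _ _) _)).trans_lt ?_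
    omega
  have h2 : (Polynomial.C (s ^ 2) * Polynomial.X ^ (2 * m) * R.denom).natDegree ≤ R.num.natDegree := by
    refine (natDegree_mul_le.trans (add_le_add_left (natDegree_C_mul_X_pow_le _ _) _)).trans ?_
    omega
  refine lt_of_le_of_ne
    (natDegree_add_le_of_degree_le (natDegree_add_le_of_degree_le le_rfl h1.le) h2) fun heq => ?_
  have h3 : (R.num + Polynomial.C s * Polynomial.X ^ m * R.denom
      + Polynomial.C (s ^ 2) * Polynomial.X ^ (2 * m) * R.denom).coeff R.num.natDegree = 0 := by
    rw [coeff_add, coeff_add, coeff_eq_zero_of_natDegree_lt h1, mul_assoc, coeff_C_mul, h,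
      coeff_X_pow_mul, R.monic_denom.coeff_natDegree, ← h, coeff_natDegree, hs, mul_one, add_zero,
      CharTwo.add_self_eq_zero]
  rw [← heq, coeff_natDegree, leadingCoeff_eq_zero] at h3
  rw [h3, natDegree_zero] at heq
  omega

end RatFunc


/-- **Artin–Schreier normalization in characteristic 2 (Hasse).** Let `k` be an algebraically
closed field of characteristic `2` and `R ∈ k(x)` a rational function.  Then there is
`Q ∈ k(x)` such that `R + Q + Q²` has no poles of even order: for every `a ∈ k` the order of
`R + Q + Q²` at `x = a` (the root multiplicity of `a` in the numerator minus that in the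
denominator) is not a negative even integer, and its order at infinity (the degree of the
denominator minus the degree of the numerator) is not a negative even integer. -/
theorem artin_schreier_no_even_order_poles
    (k : Type*) [Field k] [IsAlgClosed k] [CharP k 2] (R : RatFunc k) :
    ∃ Q : RatFunc k,
      (∀ a : k,
        ¬ ((((R + Q + Q ^ 2).num.rootMultiplicity a : ℤ) -
              ((R + Q + Q ^ 2).denom.rootMultiplicity a : ℤ) < 0) ∧
            Even (((R + Q + Q ^ 2).num.rootMultiplicity a : ℤ) -
              ((R + Q + Q ^ 2).denom.rootMultiplicity a : ℤ)))) ∧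
      ¬ ((((R + Q + Q ^ 2).denom.natDegree : ℤ) -
            ((R + Q + Q ^ 2).num.natDegree : ℤ) < 0) ∧
          Even (((R + Q + Q ^ 2).denom.natDegree : ℤ) -
            ((R + Q + Q ^ 2).num.natDegree : ℤ))) := by
  induction hn : R.height using Nat.strong_induction_on generalizing R with
  | _ n ih =>
    by_cases hlt : ∃ Q : RatFunc k, (R + Q + Q ^ 2).height < R.height
    · obtain ⟨Q₁, hQ₁⟩ := hlt
      obtain ⟨Q₂, hQ₂⟩ := ih _ (hn ▸ hQ₁) (R + Q₁ + Q₁ ^ 2) rfl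
      refine ⟨Q₁ + Q₂, ?_⟩
      have h : R + (Q₁ + Q₂) + (Q₁ + Q₂) ^ 2 = R + Q₁ + Q₁ ^ 2 + Q₂ + Q₂ ^ 2 := by
        have : CharP (RatFunc k) 2 := charP_of_injective_algebraMap
          (algebraMap k (RatFunc k)).injective 2
        rw [CharTwo.add_sq]
        ring
      rw [h]
      exact hQ₂
    · refine ⟨0, ?_⟩
      rw [add_zero, zero_pow two_ne_zero, add_zero]
      refine ⟨fun a ⟨hneg, heven⟩ => hlt ?_, fun ⟨hneg, m, hm⟩ => hlt ?_⟩
      · have hroot : R.denom.IsRoot a :=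
          (Polynomial.rootMultiplicity_pos R.denom_ne_zero).1 (by omega)
        have hnum : R.num.rootMultiplicity a = 0 := by
          refine Polynomial.rootMultiplicity_eq_zero fun hnroot => ?_
          obtain ⟨u, v, huv⟩ := R.isCoprime_num_denom
          have := congrArg (Polynomial.eval a) huv
          simp [hroot.eq_zero, hnroot.eq_zero] at this
        obtain ⟨m, hm⟩ := heven
        exact RatFunc.exists_height_lt_of_even_pole (a := a) (m := (-m).toNat)
          (by omega) (by omega)
      · exact RatFunc.exists_height_lt_of_even_pole_infty (m := (-m).toNat)
          (by omega) (by omega)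
end

section
/- For every integer g ≥ 2 there exists a finite group G of order 8(g + 1) together with elements a, b, c ∈ G such that a has order 2, b has order 4, c has order 2g + 2, a·b·c = 1, and a, b, c generate G (i.e., G admits a (0; 2, 4, 2g+2)-generating vector). Moreover these data satisfy the Riemann–Hurwitz equation 2g − 2 = |G|·(−2 + (1 − 1/2) + (1 − 1/4) + (1 − 1/(2g+2))). -/
/-- The homomorphism `ℤ/nℤ → ℤ/2ℤ` reducing modulo `2`, for even `n = 2g + 2`. -/
def parityHom (g : ℕ) : ZMod (2 * g + 2) →+* ZMod 2 :=
  ZMod.castHom ⟨g + 1, by ring⟩ (ZMod 2)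

/-- The involution `(i, j) ↦ (-i, i + j)` of `ℤ/(2g+2)ℤ × ℤ/2ℤ`. -/
def twistedNeg (g : ℕ) : ZMod (2 * g + 2) × ZMod 2 ≃+ ZMod (2 * g + 2) × ZMod 2 where
  toFun p := (-p.1, parityHom g p.1 + p.2)
  invFun p := (-p.1, parityHom g p.1 + p.2)
  left_inv p := by ext <;> simp [← add_assoc, CharTwo.add_self_eq_zero]
  right_inv p := by ext <;> simp [← add_assoc, CharTwo.add_self_eq_zero]
  map_add' p q := by
    ext
    · simp [add_comm]
    · simp [add_add_add_comm]

/-- `twistedNeg` as an automorphism of the multiplicative version of the group. -/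
def twistedInv (g : ℕ) : MulAut (Multiplicative (ZMod (2 * g + 2) × ZMod 2)) :=
  AddEquiv.toMultiplicative (twistedNeg g)

theorem twistedInv_ofAdd (g : ℕ) (p : ZMod (2 * g + 2) × ZMod 2) :
    twistedInv g (Multiplicative.ofAdd p) =
      Multiplicative.ofAdd (-p.1, parityHom g p.1 + p.2) := rfl

theorem orderOf_twistedInv (g : ℕ) : orderOf (twistedInv g) = 2 := by
  refine orderOf_eq_prime ?_ fun h => ?_
  · ext p : 1
    rw [pow_two, MulAut.mul_apply]
    exact (twistedNeg g).left_inv p.toAdd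
  · have h1 := congrArg (fun f => (f (Multiplicative.ofAdd (1, 0))).toAdd.2) h
    simp [twistedInv_ofAdd] at h1

/-- The Accola–Maclachlan group of order `8(g+1)`. -/
abbrev AccolaMaclachlan (g : ℕ) : Type :=
  Multiplicative (ZMod (2 * g + 2) × ZMod 2) ⋊[(Subgroup.zpowers (twistedInv g)).subtype]
    Subgroup.zpowers (twistedInv g)

namespace AccolaMaclachlan

theorem natCard (g : ℕ) : Nat.card (AccolaMaclachlan g) = 8 * (g + 1) := by
  rw [SemidirectProduct.card, Nat.card_zpowers, orderOf_twistedInv]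
  have : Nat.card (Multiplicative (ZMod (2 * g + 2) × ZMod 2)) = (2 * g + 2) * 2 := by
    simp
  rw [this]
  ring

/-- The inclusion of the abelian normal subgroup. -/
def incl (g : ℕ) (p : ZMod (2 * g + 2) × ZMod 2) : AccolaMaclachlan g :=
  SemidirectProduct.inl (Multiplicative.ofAdd p)

/-- The reflection acting on the abelian normal subgroup by `twistedInv`. -/
def refl (g : ℕ) : AccolaMaclachlan g :=
  SemidirectProduct.inr ⟨twistedInv g, Subgroup.mem_zpowers _⟩

theorem incl_injective (g : ℕ) : Function.Injective (incl g) :=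
  SemidirectProduct.inl_injective.comp Multiplicative.ofAdd.injective

theorem incl_zero (g : ℕ) : incl g 0 = 1 := map_one _

theorem incl_add (g : ℕ) (p q : ZMod (2 * g + 2) × ZMod 2) :
    incl g (p + q) = incl g p * incl g q := by
  simp [incl]

theorem incl_nsmul (g k : ℕ) (p : ZMod (2 * g + 2) × ZMod 2) :
    incl g (k • p) = incl g p ^ k := by
  rw [incl, ofAdd_nsmul, map_pow, incl]

theorem orderOf_incl (g : ℕ) (p : ZMod (2 * g + 2) × ZMod 2) :
    orderOf (incl g p) = addOrderOf p := by
  rw [incl, orderOf_injective _ SemidirectProduct.inl_injective, orderOf_ofAdd_eq_addOrderOf]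

theorem orderOf_refl (g : ℕ) : orderOf (refl g) = 2 := by
  rw [refl, orderOf_injective _ SemidirectProduct.inr_injective, Subgroup.orderOf_mk,
    orderOf_twistedInv]

theorem refl_mul_refl (g : ℕ) : refl g * refl g = 1 := by
  rw [← pow_two]
  exact (orderOf_dvd_iff_pow_eq_one).1 (orderOf_refl g).dvd

theorem refl_inv (g : ℕ) : (refl g)⁻¹ = refl g :=
  inv_eq_of_mul_eq_one_left (refl_mul_refl g)

theorem refl_conj (g : ℕ) (p : ZMod (2 * g + 2) × ZMod 2) :
    refl g * incl g p * (refl g)⁻¹ = incl g (-p.1, parityHom g p.1 + p.2) := by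
  rw [incl, refl, ← map_inv, ← SemidirectProduct.inl_aut]
  rfl

theorem sq_refl_inv_mul (g : ℕ) :
    ((refl g)⁻¹ * (incl g (1, 0))⁻¹) ^ 2 = incl g (0, 1) := by
  have h : (incl g (1, 0))⁻¹ = incl g (-1, 0) := by
    rw [inv_eq_iff_mul_eq_one, ← incl_add, ← incl_zero]
    simp [Prod.zero_eq_mk]
  have h2 := refl_conj g (-1, 0)
  rw [refl_inv] at h2
  rw [h, refl_inv, pow_two, ← mul_assoc, h2, ← incl_add]
  simp [CharTwo.neg_eq]

theorem incl_zero_one_ne_one (g : ℕ) : incl g (0, 1) ≠ 1 := by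
  rw [← incl_zero]
  exact (incl_injective g).ne (by simp)

theorem orderOf_refl_inv_mul (g : ℕ) :
    orderOf ((refl g)⁻¹ * (incl g (1, 0))⁻¹) = 4 := by
  refine orderOf_eq_prime_pow (p := 2) (n := 1) ?_ ?_
  · rw [pow_one, sq_refl_inv_mul]
    exact incl_zero_one_ne_one g
  · rw [pow_succ, pow_one, pow_mul, sq_refl_inv_mul, ← incl_nsmul, ← incl_zero]
    congr 1

theorem closure_eq_top (g : ℕ) :
    Subgroup.closure {refl g, (refl g)⁻¹ * (incl g (1, 0))⁻¹, incl g (1, 0)} = ⊤ := by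
  set K := Subgroup.closure {refl g, (refl g)⁻¹ * (incl g (1, 0))⁻¹, incl g (1, 0)}
  have ha : refl g ∈ K := Subgroup.subset_closure (by simp)
  have hb : (refl g)⁻¹ * (incl g (1, 0))⁻¹ ∈ K := Subgroup.subset_closure (by simp)
  have hc : incl g (1, 0) ∈ K := Subgroup.subset_closure (by simp)
  have hz : incl g (0, 1) ∈ K := sq_refl_inv_mul g ▸ pow_mem hb 2
  have hincl (p : ZMod (2 * g + 2) × ZMod 2) : incl g p ∈ K := by
    have hp : p = p.1.val • (1, 0) + p.2.val • (0, 1) := by ext <;> simp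
    rw [hp, incl_add, incl_nsmul, incl_nsmul]
    exact mul_mem (pow_mem hc _) (pow_mem hz _)
  refine (Subgroup.eq_top_iff' K).2 fun x => ?_
  rw [← SemidirectProduct.inl_left_mul_inr_right x]
  refine mul_mem (hincl x.left.toAdd) ?_
  obtain ⟨k, hk⟩ := Subgroup.mem_zpowers_iff.1 x.right.2
  have hx : x.right = ⟨twistedInv g, Subgroup.mem_zpowers _⟩ ^ k := Subtype.ext hk.symm
  rw [hx, map_zpow]
  exact zpow_mem ha k

end AccolaMaclachlan


/-- **Accola–Maclachlan bound `N(g) ≥ 8(g+1)`.** For every integer `g ≥ 2` there is a finite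
group `G` of order `8(g+1)` with elements `a, b, c` of orders `2`, `4`, `2g+2` respectively,
satisfying `a b c = 1` and generating `G` (a `(0; 2, 4, 2g+2)`-generating vector); moreover
these data satisfy the Riemann–Hurwitz equation
`2g - 2 = |G| (-2 + (1 - 1/2) + (1 - 1/4) + (1 - 1/(2g+2)))`. -/
theorem accola_maclachlan_generating_vector (g : ℕ) (hg : 2 ≤ g) :
    ∃ (G : Type) (_ : Group G) (_ : Fintype G) (a b c : G),
      Fintype.card G = 8 * (g + 1) ∧
      orderOf a = 2 ∧ orderOf b = 4 ∧ orderOf c = 2 * g + 2 ∧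
      a * b * c = 1 ∧
      Subgroup.closure {a, b, c} = ⊤ ∧
      2 * (g : ℚ) - 2 = (Fintype.card G : ℚ) *
        (-2 + (1 - 1 / 2) + (1 - 1 / 4) + (1 - 1 / (2 * (g : ℚ) + 2))) := by
  have hfin : Finite (AccolaMaclachlan g) :=
    Nat.finite_of_card_ne_zero (by rw [AccolaMaclachlan.natCard]; omega)
  let inst : Fintype (AccolaMaclachlan g) := Fintype.ofFinite _
  have hcard : Fintype.card (AccolaMaclachlan g) = 8 * (g + 1) := by
    rw [Fintype.card_eq_nat_card, AccolaMaclachlan.natCard]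
  refine ⟨AccolaMaclachlan g, inferInstance, inst, AccolaMaclachlan.refl g,
    (AccolaMaclachlan.refl g)⁻¹ * (AccolaMaclachlan.incl g (1, 0))⁻¹,
    AccolaMaclachlan.incl g (1, 0), hcard, AccolaMaclachlan.orderOf_refl g,
    AccolaMaclachlan.orderOf_refl_inv_mul g, ?_, by group, AccolaMaclachlan.closure_eq_top g, ?_⟩
  · rw [AccolaMaclachlan.orderOf_incl, Prod.addOrderOf]
    simp [ZMod.addOrderOf_one]
  · rw [hcard]
    have h : (g : ℚ) + 1 ≠ 0 := by positivity
    have h2 : 2 * (g : ℚ) + 2 ≠ 0 := by positivity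
    push_cast
    field_simp
    ring
end
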